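/- Let K ∈ ℝ, N ∈ [1,∞) and let (X,d,m) be a CD*(K,N) metric measure space having the good transport property (GT). Then for every mu, nu ∈ P2(X) with mu << m there exists a unique plan pi ∈ OptGeo(mu,nu). Furthermore this plan is induced by a map, i.e. there is a Borel map T : X -> Geo(X) with pi = T#mu, and pi is concentrated on a set of non-branching geodesics: there is a Borel set Gamma ⊂ Geo(X) with pi(Gamma) = 1 such that for every t ∈ [0,1) the restriction of the evaluation map e_t to Gamma is injective. -/

import Mathlib

open MeasureTheory Metric Set unitInterval ENNReal NNReal

noncomputable section

variable {X : Type*} [MetricSpace X]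

/-- A constant speed minimizing geodesic parametrized on `[0,1]`. -/
def IsUnitGeodesic (γ : C(unitInterval, X)) : Prop :=
  ∀ s t : unitInterval, dist (γ s) (γ t) = |(s : ℝ) - (t : ℝ)| * dist (γ 0) (γ 1)

/-- The space of constant speed minimizing geodesics, with the sup distance. -/
def Geo (X : Type*) [MetricSpace X] : Type _ :=
  { γ : C(unitInterval, X) // IsUnitGeodesic γ }

instance : MetricSpace (Geo X) := Subtype.metricSpace
instance : MeasurableSpace (Geo X) := borel _
instance : BorelSpace (Geo X) := ⟨rfl⟩

/-- Evaluation map `e_t`. -/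
def eval (t : unitInterval) (γ : Geo X) : X := γ.1 t

/-- `(X,d)` is a geodesic space: any two points are joined by a geodesic. -/
def IsGeodesicSpace (X : Type*) [MetricSpace X] : Prop :=
  ∀ x y : X, ∃ γ : Geo X, eval 0 γ = x ∧ eval 1 γ = y

/-- The (topological) support of a measure. -/
def measSupport {Y : Type*} [TopologicalSpace Y] [MeasurableSpace Y] (μ : Measure Y) : Set Y :=
  {y | ∀ U ∈ nhds y, 0 < μ U}

variable [MeasurableSpace X]

/-- Finite second moment. -/
def HasFiniteSecondMoment (μ : Measure X) : Prop :=
  ∃ x₀ : X, ∫⁻ x, ENNReal.ofReal (dist x x₀ ^ 2) ∂μ ≠ ⊤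

/-- The transport cost of a plan on the space of geodesics. -/
def transportCost (π : Measure (Geo X)) : ℝ≥0∞ :=
  ∫⁻ γ, ENNReal.ofReal (dist (eval 0 γ) (eval 1 γ) ^ 2) ∂π

/-- `π ∈ OptGeo(μ,ν)`: an optimal geodesic plan from `μ` to `ν`. -/
def IsOptGeo (μ ν : Measure X) (π : Measure (Geo X)) : Prop :=
  IsProbabilityMeasure π ∧ π.map (eval 0) = μ ∧ π.map (eval 1) = ν ∧
    ∀ π' : Measure (Geo X), IsProbabilityMeasure π' →
      π'.map (eval 0) = μ → π'.map (eval 1) = ν →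
      transportCost π ≤ transportCost π'

/-- The distortion coefficients `σ_{K,N}^{(t)}(θ)`. -/
def sigmaCoeff (K N t θ : ℝ) : ℝ≥0∞ :=
  if N * Real.pi ^ 2 ≤ K * θ ^ 2 then ⊤
  else if 0 < K * θ ^ 2 then
    ENNReal.ofReal (Real.sin (t * θ * Real.sqrt (K / N)) / Real.sin (θ * Real.sqrt (K / N)))
  else if K * θ ^ 2 = 0 then ENNReal.ofReal t
  else ENNReal.ofReal (Real.sinh (t * θ * Real.sqrt (-K / N)) / Real.sinh (θ * Real.sqrt (-K / N)))

/-- The distortion coefficients `τ_{K,N}^{(t)}(θ)`. -/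
def tauCoeff (K N t θ : ℝ) : ℝ≥0∞ :=
  if N = 1 then
    (if K ≤ 0 then ENNReal.ofReal t else if θ = 0 then ENNReal.ofReal t else ⊤)
  else ENNReal.ofReal t ^ (1 / N) * sigmaCoeff K (N - 1) t θ ^ ((N - 1) / N)

/-- The (reduced) curvature dimension condition `CD*(K,N)`. -/
def IsCDStar (K N : ℝ) (m : Measure X) : Prop :=
  ∀ μ₀ μ₁ : Measure X, IsProbabilityMeasure μ₀ → IsProbabilityMeasure μ₁ →
    (∃ s : Set X, Bornology.IsBounded s ∧ μ₀ sᶜ = 0 ∧ μ₁ sᶜ = 0) →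
    ∃ π : Measure (Geo X), IsOptGeo μ₀ μ₁ π ∧
      ∀ t : unitInterval, ∀ N' : ℝ, N ≤ N' →
        ∫⁻ γ, (sigmaCoeff K N' (1 - (t : ℝ)) (dist (eval 0 γ) (eval 1 γ)) *
                 ((π.map (eval 0)).rnDeriv m (eval 0 γ)) ^ (-(1 / N')) +
               sigmaCoeff K N' (t : ℝ) (dist (eval 0 γ) (eval 1 γ)) *
                 ((π.map (eval 1)).rnDeriv m (eval 1 γ)) ^ (-(1 / N'))) ∂π
          ≤ ∫⁻ x, ((π.map (eval t)).rnDeriv m x) ^ (1 - 1 / N') ∂m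

/-- The good transport property (GT): between absolutely continuous measures in `P₂(X)` there is
a unique optimal geodesic plan, and it is induced by a map from every intermediate time. -/
def GoodTransport (m : Measure X) : Prop :=
  ∀ μ ν : Measure X, IsProbabilityMeasure μ → IsProbabilityMeasure ν →
    HasFiniteSecondMoment μ → HasFiniteSecondMoment ν → μ ≪ m → ν ≪ m →
    (∃! π : Measure (Geo X), IsOptGeo μ ν π) ∧
    ∀ π : Measure (Geo X), IsOptGeo μ ν π → ∀ t : unitInterval,
      ∃ T : X → Geo X, Measurable T ∧ π = (π.map (eval t)).map T

/-- `c`-concavity (with `c = d²/2`) for functions with values in `ℝ ∪ {-∞}`. -/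
def cConcave (φ : X → EReal) : Prop :=
  (∃ x, φ x ≠ ⊥) ∧ (∀ x, φ x ≠ ⊤) ∧
    ∃ ψ : X → EReal, (∀ y, ψ y ≠ ⊤) ∧
      ∀ x, φ x = ⨅ y, ((dist x y ^ 2 / 2 : ℝ) : EReal) - ψ y

/-- The `c`-transform `φᶜ`. -/
def cTransform (φ : X → EReal) : X → EReal :=
  fun y => ⨅ x, ((dist x y ^ 2 / 2 : ℝ) : EReal) - φ x

/-- The `c`-superdifferential `∂ᶜφ`. -/
def cSuperdiff (φ : X → EReal) : Set (X × X) :=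
  {p | φ p.1 + cTransform φ p.2 = ((dist p.1 p.2 ^ 2 / 2 : ℝ) : EReal)}

/-- Kantorovich potential from `μ` to `ν`. -/
def IsKantorovichPotential (μ ν : Measure X) (φ : X → EReal) : Prop :=
  cConcave φ ∧ ∀ π : Measure (Geo X), IsOptGeo μ ν π →
    measSupport (π.map (fun γ => (eval 0 γ, eval 1 γ))) ⊆ cSuperdiff φ


section geoTop
variable {Y : Type*} [MetricSpace Y]

theorem geo_eval_continuous2 : Continuous (fun p : Geo Y × unitInterval => eval p.2 p.1) := by
  unfold eval
  have h1 : Continuous (fun p : Geo Y × unitInterval => (p.1.1 : C(unitInterval, Y))) :=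
    (continuous_subtype_val (p := fun γ : C(unitInterval, Y) => IsUnitGeodesic γ)).comp continuous_fst
  exact continuous_eval.comp (h1.prodMk continuous_snd)

theorem geo_eval_continuous (t : unitInterval) : Continuous (eval t : Geo Y → Y) :=
  geo_eval_continuous2.comp (continuous_id.prodMk continuous_const)

theorem geo_dist (γ : Geo Y) (s t : unitInterval) :
    dist (eval s γ) (eval t γ) = |(s : ℝ) - t| * dist (eval 0 γ) (eval 1 γ) := γ.2 s t

theorem isClosed_geodesic : IsClosed {γ : C(unitInterval, Y) | IsUnitGeodesic γ} := by
  have : {γ : C(unitInterval, Y) | IsUnitGeodesic γ} = ⋂ s : unitInterval, ⋂ t : unitInterval,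
      {γ | dist (γ s) (γ t) = |(s : ℝ) - (t : ℝ)| * dist (γ 0) (γ 1)} := by
    ext γ; simp only [IsUnitGeodesic, Set.mem_setOf_eq, Set.mem_iInter]
  rw [this]
  refine isClosed_iInter fun s => isClosed_iInter fun t => isClosed_eq ?_ ?_ <;> fun_prop

theorem geo_isClosedEmbedding :
    Topology.IsClosedEmbedding (fun γ : Geo Y => (γ.1 : C(unitInterval, Y))) :=
  isClosed_geodesic.isClosedEmbedding_subtypeVal

instance geoSecondCountable [ProperSpace Y] : SecondCountableTopology (Geo Y) :=
  (geo_isClosedEmbedding (Y := Y)).isEmbedding.secondCountableTopology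

instance geoComplete [ProperSpace Y] : CompleteSpace (Geo Y) :=
  isClosed_geodesic.isComplete.completeSpace_coe

theorem geo_isCompact [ProperSpace Y] {K : Set Y} (hK : IsCompact K) :
    IsCompact {γ : Geo Y | eval 0 γ ∈ K ∧ eval 1 γ ∈ K} := by
  have h : IsCompact {γ : C(unitInterval, Y) | IsUnitGeodesic γ ∧ γ 0 ∈ K ∧ γ 1 ∈ K} := by
    obtain ⟨R, hR⟩ : ∃ R, ∀ x ∈ K, ∀ y ∈ K, dist x y ≤ R := by
      obtain ⟨R, hR⟩ := Metric.isBounded_iff.1 hK.isBounded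
      exact ⟨R, fun x hx y hy => hR hx hy⟩
    apply ArzelaAscoli.isCompact_of_equicontinuous
    · have : ContinuousMap.toFun '' {γ : C(unitInterval, Y) | IsUnitGeodesic γ ∧ γ 0 ∈ K ∧ γ 1 ∈ K}
        = {f : unitInterval → Y | (∀ s t : unitInterval,
            dist (f s) (f t) = |(s : ℝ) - (t : ℝ)| * dist (f 0) (f 1)) ∧ f 0 ∈ K ∧ f 1 ∈ K} := by
        ext f
        constructor
        · rintro ⟨γ, ⟨h1, h2, h3⟩, rfl⟩
          exact ⟨h1, h2, h3⟩
        · rintro ⟨h1, h2, h3⟩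
          have hc : Continuous f := by
            apply LipschitzWith.continuous (K := ⟨dist (f 0) (f 1), dist_nonneg⟩)
            refine LipschitzWith.of_dist_le_mul fun s t => ?_
            rw [h1 s t, mul_comm]
            rfl
          exact ⟨⟨f, hc⟩, ⟨h1, h2, h3⟩, rfl⟩
      rw [this]
      rcases K.eq_empty_or_nonempty with rfl | ⟨x₀, hx₀⟩
      · convert isCompact_empty
        ext f; simp
      refine IsCompact.of_isClosed_subset
        (isCompact_univ_pi fun _ : unitInterval => isCompact_closedBall x₀ (R + R)) ?_ ?_
      · have e : {f : unitInterval → Y | (∀ s t : unitInterval,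
            dist (f s) (f t) = |(s : ℝ) - (t : ℝ)| * dist (f 0) (f 1)) ∧ f 0 ∈ K ∧ f 1 ∈ K}
            = (⋂ s : unitInterval, ⋂ t : unitInterval, {f : unitInterval → Y |
            dist (f s) (f t) = |(s : ℝ) - (t : ℝ)| * dist (f 0) (f 1)}) ∩
            ({f | f 0 ∈ K} ∩ {f | f 1 ∈ K}) := by
          ext f; simp only [Set.mem_setOf_eq, Set.mem_iInter, Set.mem_inter_iff]
        rw [e]
        refine IsClosed.inter (isClosed_iInter fun s => isClosed_iInter fun t =>
          isClosed_eq (by fun_prop) (by fun_prop)) (IsClosed.inter ?_ ?_)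
        · exact hK.isClosed.preimage (continuous_apply 0)
        · exact hK.isClosed.preimage (continuous_apply 1)
      · rintro f ⟨h1, h2, h3⟩ t -
        rw [mem_closedBall]
        have a1 := h1 t 0
        have a2 := hR _ h2 _ h3
        have a3 := hR _ h2 _ hx₀
        have a4 : |((t : ℝ)) - ((0 : unitInterval) : ℝ)| ≤ 1 := by
          rw [abs_le]; constructor <;> simp <;> linarith [t.2.1, t.2.2]
        have := dist_triangle (f t) (f 0) x₀
        nlinarith [dist_nonneg (x := f 0) (y := f 1)]
    · apply LipschitzWith.uniformEquicontinuous _ (Real.toNNReal R) _ |>.equicontinuous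
      rintro ⟨γ, h1, h2, h3⟩
      refine LipschitzWith.of_dist_le_mul fun s t => ?_
      change dist (γ s) (γ t) ≤ _
      rw [h1 s t, mul_comm]
      refine mul_le_mul_of_nonneg_right ?_ (abs_nonneg _)
      exact (hR _ h2 _ h3).trans (Real.le_coe_toNNReal R)
  have := (geo_isClosedEmbedding (Y := Y)).isCompact_preimage h
  convert this using 1
  ext γ
  constructor
  · rintro ⟨h1, h2⟩; exact ⟨γ.2, h1, h2⟩
  · rintro ⟨_, h1, h2⟩; exact ⟨h1, h2⟩

/-- restriction of a geodesic to `[0,s]` -/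
def restr (s : unitInterval) (γ : Geo Y) : Geo Y :=
  ⟨γ.1.comp ⟨fun t => s * t, by fun_prop⟩, by
    intro a b
    have h := γ.2
    simp only [ContinuousMap.comp_apply, ContinuousMap.coe_mk]
    rw [h (s * a) (s * b), h (s * 0) (s * 1)]
    have e1 : |(((s * a : unitInterval)) : ℝ) - ((s * b : unitInterval) : ℝ)| = s * |(a : ℝ) - b| := by
      rw [Set.Icc.coe_mul, Set.Icc.coe_mul, ← mul_sub, abs_mul, abs_of_nonneg s.2.1]
    have e2 : |(((s * 0 : unitInterval)) : ℝ) - ((s * 1 : unitInterval) : ℝ)| = s := by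
      simp [abs_of_nonneg s.2.1]
    rw [e1, e2]
    ring⟩

@[simp] theorem eval_restr (s t : unitInterval) (γ : Geo Y) :
    eval t (restr s γ) = eval (s * t) γ := rfl

theorem restr_continuous (s : unitInterval) : Continuous (restr s : Geo Y → Geo Y) := by
  refine Continuous.subtype_mk ?_ _
  exact (ContinuousMap.continuous_precomp _).comp continuous_subtype_val

theorem geo_ext {γ η : Geo Y} (h : ∀ t, eval t γ = eval t η) : γ = η :=
  Subtype.ext (ContinuousMap.ext h)

end geoTop

theorem exists_selection {Y Z : Type*} [TopologicalSpace Y] [T2Space Y] [MeasurableSpace Y]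
    [BorelSpace Y] [MetricSpace Z] [MeasurableSpace Z] [BorelSpace Z] [Nonempty Z]
    {A : Set (Y × Z)} (hA : IsCompact A) :
    ∃ f : Y → Z, Measurable f ∧ ∀ y ∈ Prod.fst '' A, (y, f y) ∈ A := by
  classical
  rcases A.eq_empty_or_nonempty with rfl | hne
  · exact ⟨fun _ => Classical.arbitrary Z, measurable_const, by simp⟩
  have hK : IsCompact (Prod.snd '' A) := hA.image continuous_snd
  have : CompactSpace (Prod.snd '' A) := isCompact_iff_compactSpace.1 hK
  have : Nonempty (Prod.snd '' A) := (hne.image _).to_subtype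
  obtain ⟨g0, hg0, hg0s⟩ := exists_nat_bool_continuous_surjective_of_compact (Prod.snd '' A)
  let g : cantorSet → Z := fun c => (g0 (cantorSetHomeomorphNatToBool c)).1
  have hg : Continuous g := by fun_prop
  have hgs : ∀ z ∈ Prod.snd '' A, ∃ c, g c = z := by
    intro z hz
    obtain ⟨b, hb⟩ := hg0s ⟨z, hz⟩
    exact ⟨cantorSetHomeomorphNatToBool.symm b, by simp [g, hb]⟩
  have : CompactSpace cantorSet := isCompact_iff_compactSpace.1 isCompact_cantorSet
  let A2 : Set (Y × cantorSet) := {p | (p.1, g p.2) ∈ A}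
  have hA2c : IsClosed A2 := hA.isClosed.preimage (by fun_prop)
  have hA1 : IsCompact (Prod.fst '' A) := hA.image continuous_fst
  have hA2 : IsCompact A2 := by
    refine IsCompact.of_isClosed_subset (hA1.prod (isCompact_univ (X := cantorSet))) hA2c ?_
    rintro ⟨y, c⟩ h
    exact ⟨⟨_, h, rfl⟩, trivial⟩
  let S : Y → Set ℝ := fun y => {r | ∃ c : cantorSet, (y, c) ∈ A2 ∧ (c : ℝ) = r}
  let φ : Y → ℝ := fun y => sInf (S y)
  have hSc : ∀ y, IsCompact (S y) := by
    intro y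
    have h1 : IsCompact {c : cantorSet | (y, c) ∈ A2} :=
      (hA2c.preimage (by fun_prop : Continuous fun c : cantorSet => (y, c))).isCompact
    have := h1.image (continuous_subtype_val)
    exact this
  have hmem : ∀ y ∈ Prod.fst '' A, φ y ∈ S y := by
    rintro _ ⟨⟨y, z⟩, h, rfl⟩
    obtain ⟨c, hc⟩ := hgs z ⟨_, h, rfl⟩
    refine (hSc y).sInf_mem ⟨c, c, ?_, rfl⟩
    change (y, g c) ∈ A
    rw [hc]; exact h
  have hφ : Measurable φ := by
    apply measurable_of_Iic
    intro a
    have e : φ ⁻¹' Set.Iic a = (Prod.fst '' (A2 ∩ {p | (p.2 : ℝ) ≤ a})) ∪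
        ((Prod.fst '' A)ᶜ ∩ {_y | (0 : ℝ) ≤ a}) := by
      ext y
      by_cases hy : y ∈ Prod.fst '' A
      · have hy' : y ∉ (Prod.fst '' A)ᶜ ∩ {_y : Y | (0 : ℝ) ≤ a} := fun h => h.1 hy
        constructor
        · intro h
          left
          obtain ⟨c, hc, hc2⟩ := hmem y hy
          exact ⟨(y, c), ⟨hc, by change (c : ℝ) ≤ a; rw [hc2]; exact h⟩, rfl⟩
        · rintro (⟨⟨y', c⟩, ⟨h1, h2⟩, rfl⟩ | h)
          · exact (csInf_le (hSc _).bddBelow ⟨c, h1, rfl⟩).trans h2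
          · exact absurd h hy'
      · have hS : S y = ∅ := by
          ext r
          simp only [Set.mem_empty_iff_false, iff_false]
          rintro ⟨c, hc, -⟩
          exact hy ⟨_, hc, rfl⟩
        have h0 : φ y = 0 := by simp [φ, hS]
        constructor
        · intro h
          right
          refine ⟨hy, ?_⟩
          have h : φ y ≤ a := h
          rw [h0] at h; exact h
        · rintro (⟨⟨y', c⟩, ⟨h1, h2⟩, rfl⟩ | h)
          · exact absurd ⟨_, h1, rfl⟩ hy
          · change φ y ≤ a
            rw [h0]; exact h.2
    rw [e]
    refine MeasurableSet.union ?_ (hA1.measurableSet.compl.inter (MeasurableSet.const _))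
    refine IsCompact.measurableSet ?_
    refine (hA2.inter_right ?_).image continuous_fst
    exact isClosed_le (by fun_prop) continuous_const
  let G : ℝ → Z := fun r => if h : r ∈ cantorSet then g ⟨r, h⟩ else Classical.arbitrary Z
  have hG : Measurable G :=
    Measurable.dite hg.measurable measurable_const isCompact_cantorSet.measurableSet
  refine ⟨G ∘ φ, hG.comp hφ, fun y hy => ?_⟩
  obtain ⟨c, hc, hc2⟩ := hmem y hy
  have : (G ∘ φ) y = g c := by
    simp [G, ← hc2]
  rw [this]; exact hc

/-- measurable geodesic selection -/
theorem exists_geo_selection [ProperSpace X] [BorelSpace X] (hX : IsGeodesicSpace X) :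
    ∃ g : X × X → Geo X, Measurable g ∧ ∀ p, eval 0 (g p) = p.1 ∧ eval 1 (g p) = p.2 := by
  classical
  rcases isEmpty_or_nonempty X with hE | ⟨⟨x₀⟩⟩
  · exact ⟨fun p => (hE.false p.1).elim, measurable_of_empty _, fun p => (hE.false p.1).elim⟩
  have : Nonempty (Geo X) := ⟨(hX x₀ x₀).choose⟩
  let K : ℕ → Set X := fun n => closedBall x₀ n
  let A : ℕ → Set ((X × X) × Geo X) := fun n =>
    {q | (q.1.1 = eval 0 q.2 ∧ q.1.2 = eval 1 q.2) ∧ (eval 0 q.2 ∈ K n ∧ eval 1 q.2 ∈ K n)}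
  have hA : ∀ n, IsCompact (A n) := by
    intro n
    have h1 := geo_isCompact (isCompact_closedBall x₀ (n : ℝ))
    have h2 := h1.image (f := fun γ : Geo X => ((eval 0 γ, eval 1 γ), γ))
      (((geo_eval_continuous 0).prodMk (geo_eval_continuous 1)).prodMk continuous_id)
    convert h2 using 1
    ext ⟨⟨x, y⟩, γ⟩
    constructor
    · rintro ⟨⟨h1, h2⟩, h3⟩
      exact ⟨γ, h3, by simp at h1 h2; simp [h1, h2]⟩
    · rintro ⟨γ', h3, h4⟩
      simp only [Prod.mk.injEq] at h4
      obtain ⟨⟨rfl, rfl⟩, rfl⟩ := h4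
      exact ⟨⟨rfl, rfl⟩, h3⟩
  choose f hf hfA using fun n => exists_selection (hA n)
  have hex : ∀ p : X × X, ∃ n : ℕ, p.1 ∈ K n ∧ p.2 ∈ K n := by
    intro p
    obtain ⟨n, hn⟩ := exists_nat_ge (max (dist p.1 x₀) (dist p.2 x₀))
    exact ⟨n, (le_max_left _ _).trans hn, (le_max_right _ _).trans hn⟩
  refine ⟨fun p => f (Nat.find (hex p)) p, ?_, ?_⟩
  · have hfind : Measurable fun p => Nat.find (hex p) := by
      refine measurable_find hex fun n => ?_
      have : IsClosed {p : X × X | p.1 ∈ K n ∧ p.2 ∈ K n} :=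
        (isClosed_closedBall.preimage continuous_fst).inter
          (isClosed_closedBall.preimage continuous_snd)
      exact this.measurableSet
    have h2 : Measurable (fun q : (X × X) × ℕ => f q.2 q.1) :=
      measurable_from_prod_countable_left fun n => hf n
    exact h2.comp (measurable_id.prodMk hfind)
  · intro p
    have h := Nat.find_spec (hex p)
    obtain ⟨γ, h0, h1⟩ := hX p.1 p.2
    have := hfA (Nat.find (hex p)) p ⟨(p, γ), ⟨⟨h0.symm, h1.symm⟩, by rw [h0, h1]; exact h⟩, rfl⟩
    exact ⟨this.1.1.symm, this.1.2.symm⟩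

/-- quadratic cost -/
def cst (p : X × X) : ℝ≥0∞ := ENNReal.ofReal (dist p.1 p.2 ^ 2)

/-- finite cost optimal couplings, not normalized -/
structure OptC (κ : Measure (X × X)) : Prop where
  fin : IsFiniteMeasure κ
  cost : ∫⁻ p, cst p ∂κ ≠ ⊤
  opt : ∀ κ' : Measure (X × X), κ'.map Prod.fst = κ.map Prod.fst → κ'.map Prod.snd = κ.map Prod.snd →
    ∫⁻ p, cst p ∂κ ≤ ∫⁻ p, cst p ∂κ'

/-- endpoints of a geodesic -/
def ends (γ : Geo X) : X × X := (eval 0 γ, eval 1 γ)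

theorem OptC.mono {κ κ' : Measure (X × X)} (h : OptC κ) (hle : κ' ≤ κ) : OptC κ' := by
  have := h.fin
  have hf : IsFiniteMeasure κ' := isFiniteMeasure_of_le κ hle
  have e : κ - κ' + κ' = κ := Measure.sub_add_cancel_of_le hle
  set τ := κ - κ' with hτ
  have hc : ∫⁻ p, cst p ∂τ + ∫⁻ p, cst p ∂κ' = ∫⁻ p, cst p ∂κ := by
    rw [← lintegral_add_measure, e]
  have hne := h.cost
  rw [← hc, ENNReal.add_ne_top] at hne
  refine ⟨hf, hne.2, fun κ'' h1 h2 => ?_⟩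
  have := h.opt (τ + κ'') ?_ ?_
  · rw [← hc, lintegral_add_measure] at this
    exact (ENNReal.add_le_add_iff_left hne.1).1 this
  · rw [Measure.map_add _ _ measurable_fst, h1, ← Measure.map_add _ _ measurable_fst, e]
  · rw [Measure.map_add _ _ measurable_snd, h2, ← Measure.map_add _ _ measurable_snd, e]

theorem OptC.smul {κ : Measure (X × X)} (h : OptC κ) {c : ℝ≥0∞} (hc : c ≠ ⊤) : OptC (c • κ) := by
  have := h.fin
  rcases eq_or_ne c 0 with rfl | h0
  · simp only [zero_smul]
    exact ⟨inferInstance, by simp, by simp⟩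
  refine ⟨Measure.smul_finite κ hc, ?_, fun κ' h1 h2 => ?_⟩
  · rw [lintegral_smul_measure]
    exact ENNReal.mul_ne_top hc h.cost
  have := h.opt (c⁻¹ • κ') ?_ ?_
  · rw [lintegral_smul_measure] at this ⊢
    calc c • ∫⁻ p, cst p ∂κ ≤ c • (c⁻¹ • ∫⁻ p, cst p ∂κ') := by gcongr
      _ = _ := by rw [smul_smul, ENNReal.mul_inv_cancel h0 hc, one_smul]
  · rw [Measure.map_smul, h1, Measure.map_smul, smul_smul, ENNReal.inv_mul_cancel h0 hc,
      one_smul]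
  · rw [Measure.map_smul, h2, Measure.map_smul, smul_smul, ENNReal.inv_mul_cancel h0 hc,
      one_smul]

theorem OptC.of_same {κ κ' : Measure (X × X)} (h : OptC κ) (h1 : κ'.map Prod.fst = κ.map Prod.fst)
    (h2 : κ'.map Prod.snd = κ.map Prod.snd) (hc : ∫⁻ p, cst p ∂κ' ≤ ∫⁻ p, cst p ∂κ) : OptC κ' := by
  have := h.fin
  refine ⟨⟨?_⟩, (hc.trans_lt h.cost.lt_top).ne, fun κ'' h3 h4 =>
    hc.trans (h.opt _ (h3.trans h1) (h4.trans h2))⟩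
  have : κ' univ = κ univ := by
    rw [← preimage_univ (f := Prod.fst), ← Measure.map_apply measurable_fst .univ, h1,
      Measure.map_apply measurable_fst .univ]
  rw [this]; exact measure_lt_top _ _

section
variable [BorelSpace X]

theorem measurable_eval (t : unitInterval) : Measurable (eval t : Geo X → X) :=
  (geo_eval_continuous t).measurable

theorem measurable_ends [ProperSpace X] : Measurable (ends : Geo X → X × X) :=
  (measurable_eval 0).prodMk (measurable_eval 1)

theorem measurable_cst [ProperSpace X] : Measurable (cst : X × X → ℝ≥0∞) := by
  unfold cst; fun_prop

theorem map_ends_fst [ProperSpace X] (π : Measure (Geo X)) :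
    (π.map ends).map Prod.fst = π.map (eval 0) := by
  rw [Measure.map_map measurable_fst measurable_ends]; rfl

theorem map_ends_snd [ProperSpace X] (π : Measure (Geo X)) :
    (π.map ends).map Prod.snd = π.map (eval 1) := by
  rw [Measure.map_map measurable_snd measurable_ends]; rfl

theorem lint_ends [ProperSpace X] (π : Measure (Geo X)) :
    ∫⁻ p, cst p ∂(π.map ends) = transportCost π := by
  rw [lintegral_map measurable_cst measurable_ends]; rfl

theorem IsOptGeo.optC [ProperSpace X] (hX : IsGeodesicSpace X) {μ ν : Measure X}
    {π : Measure (Geo X)}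
    (h : IsOptGeo μ ν π) (hc : transportCost π ≠ ⊤) : OptC (π.map ends) := by
  obtain ⟨hp, h0, h1, hopt⟩ := h
  refine ⟨inferInstance, by rwa [lint_ends], fun κ' e1 e2 => ?_⟩
  rw [map_ends_fst] at e1
  rw [map_ends_snd] at e2
  obtain ⟨g, hg, hgp⟩ := exists_geo_selection hX
  have hge : ends ∘ g = id := by
    ext p
    · exact (hgp p).1
    · exact (hgp p).2
  have hge' : (κ'.map g).map ends = κ' := by
    rw [Measure.map_map measurable_ends hg, hge, Measure.map_id]
  have m0 : (κ'.map g).map (eval 0) = π.map (eval 0) := by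
    rw [← map_ends_fst, hge', e1]
  have m1 : (κ'.map g).map (eval 1) = π.map (eval 1) := by
    rw [← map_ends_snd, hge', e2]
  rw [lint_ends]
  have := hopt (κ'.map g) ?_ (m0.trans h0) (m1.trans h1)
  · rwa [← lint_ends (κ'.map g), hge'] at this
  · constructor
    rw [← preimage_univ (f := eval 0), ← Measure.map_apply (measurable_eval 0) .univ, m0,
      Measure.map_apply (measurable_eval 0) .univ, preimage_univ, measure_univ]

theorem OptC.isOptGeo [ProperSpace X] {π : Measure (Geo X)} [IsProbabilityMeasure π]
    (h : OptC (π.map ends)) : IsOptGeo (π.map (eval 0)) (π.map (eval 1)) π := by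
  refine ⟨inferInstance, rfl, rfl, fun π' _ e0 e1 => ?_⟩
  rw [← lint_ends, ← lint_ends]
  refine h.opt _ ?_ ?_
  · rw [map_ends_fst, map_ends_fst, e0]
  · rw [map_ends_snd, map_ends_snd, e1]

open ProbabilityTheory in
theorem exists_glue [ProperSpace X] [Nonempty X] (κ₁ κ₂ : Measure (X × X)) [IsFiniteMeasure κ₁]
    [IsFiniteMeasure κ₂] (h : κ₁.map Prod.snd = κ₂.map Prod.fst) :
    ∃ θ : Measure ((X × X) × X), θ.map Prod.fst = κ₁ ∧ θ.map (fun p => (p.1.2, p.2)) = κ₂ := by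
  let k := κ₂.condKernel
  let k' : Kernel (X × X) X := k.comap Prod.snd measurable_snd
  refine ⟨κ₁ ⊗ₘ k', ?_, ?_⟩
  · exact Measure.fst_compProd κ₁ k'
  · have h2 : κ₂.fst ⊗ₘ k = κ₂ := κ₂.disintegrate κ₂.condKernel
    conv_rhs => rw [← h2]
    ext s hs
    rw [Measure.map_apply (by fun_prop) hs, Measure.compProd_apply hs,
      Measure.compProd_apply (hs.preimage (by fun_prop)), Measure.fst, ← h,
      lintegral_map (Kernel.measurable_kernel_prodMk_left hs) measurable_snd]
    rfl
end

section
variable [BorelSpace X] [ProperSpace X]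

theorem cst_restr (s : unitInterval) (γ : Geo X) :
    cst (ends (restr s γ)) = ENNReal.ofReal ((s : ℝ) ^ 2) * cst (ends γ) := by
  unfold cst ends
  simp only [eval_restr, mul_zero, mul_one]
  rw [geo_dist γ 0 s, ← ENNReal.ofReal_mul (by positivity)]
  simp [abs_of_nonneg s.2.1, mul_pow]

theorem OptC.restr [Nonempty X] {π : Measure (Geo X)} [IsFiniteMeasure π]
    (h : OptC (π.map ends)) {s : unitInterval} (hs0 : 0 < (s : ℝ)) (hs1 : (s : ℝ) < 1) :
    OptC ((π.map (restr s)).map ends) := by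
  have hr : Measurable (_root_.restr s : Geo X → Geo X) := (restr_continuous s).measurable
  have hcost : ∫⁻ p, cst p ∂((π.map (_root_.restr s)).map ends) =
      ENNReal.ofReal ((s : ℝ) ^ 2) * ∫⁻ p, cst p ∂(π.map ends) := by
    have hce : Measurable (fun γ : Geo X => cst (ends γ)) := measurable_cst.comp measurable_ends
    rw [lintegral_map measurable_cst measurable_ends, lintegral_map
      hce hr, lintegral_map measurable_cst measurable_ends,
      ← lintegral_const_mul _ hce]
    simp_rw [cst_restr]
  refine ⟨inferInstance, ?_, fun κ' h1 h2 => ?_⟩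
  · rw [hcost]; exact ENNReal.mul_ne_top ENNReal.ofReal_ne_top h.cost
  rw [hcost]
  rw [map_ends_fst, Measure.map_map (measurable_eval 0) hr] at h1
  rw [map_ends_snd, Measure.map_map (measurable_eval 1) hr] at h2
  have e0 : (eval 0 : Geo X → X) ∘ _root_.restr s = eval 0 := by
    ext γ; simp
  have e1 : (eval 1 : Geo X → X) ∘ _root_.restr s = eval s := by
    ext γ; simp
  rw [e0] at h1; rw [e1] at h2
  have hse : Measurable (fun γ : Geo X => (eval s γ, eval 1 γ)) :=
    (measurable_eval s).prodMk (measurable_eval 1)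
  have hfin : IsFiniteMeasure κ' := by
    constructor
    rw [← preimage_univ (f := Prod.fst), ← Measure.map_apply measurable_fst .univ, h1]
    exact measure_lt_top _ _
  obtain ⟨θ, hθ1, hθ2⟩ := exists_glue κ' (π.map (fun γ => (eval s γ, eval 1 γ))) (by
    rw [h2, Measure.map_map measurable_fst hse]; rfl)
  have hm1 : Measurable (fun p : (X × X) × X => (p.1.1, p.2)) := by fun_prop
  have hm2 : Measurable (fun p : (X × X) × X => (p.1.2, p.2)) := by fun_prop
  have key := h.opt (θ.map (fun p => (p.1.1, p.2))) ?_ ?_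
  rotate_left
  · rw [map_ends_fst, ← h1, ← hθ1, Measure.map_map measurable_fst hm1,
      Measure.map_map measurable_fst measurable_fst]; rfl
  · rw [map_ends_snd, Measure.map_map measurable_snd hm1]
    have : π.map (eval 1) = (π.map (fun γ => (eval s γ, eval 1 γ))).map Prod.snd := by
      rw [Measure.map_map measurable_snd hse]; rfl
    rw [this, ← hθ2, Measure.map_map measurable_snd hm2]; rfl
  have hpt : ∀ p : (X × X) × X, cst (p.1.1, p.2) ≤
      ENNReal.ofReal (1 / s) * cst p.1 + ENNReal.ofReal (1 / (1 - s)) * cst (p.1.2, p.2) := by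
    intro p
    unfold cst
    rw [← ENNReal.ofReal_mul (by positivity), ← ENNReal.ofReal_mul (by
      have : 0 < 1 - (s : ℝ) := by linarith
      positivity), ← ENNReal.ofReal_add (by positivity) (by
      have : 0 < 1 - (s : ℝ) := by linarith
      positivity)]
    apply ENNReal.ofReal_le_ofReal
    have ht := dist_triangle p.1.1 p.1.2 p.2
    set a := dist p.1.1 p.1.2
    set b := dist p.1.2 p.2
    have h1s : 0 < 1 - (s : ℝ) := by linarith
    have h1 : dist p.1.1 p.2 ^ 2 ≤ (a + b) ^ 2 := by gcongr
    refine h1.trans ?_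
    have : 1 / (s : ℝ) * a ^ 2 + 1 / (1 - s) * b ^ 2 - (a + b) ^ 2
        = ((1 - s) * a - s * b) ^ 2 / (s * (1 - s)) := by
      field_simp; ring
    have h2 : 0 ≤ ((1 - s) * a - s * b) ^ 2 / (s * (1 - s)) := by positivity
    linarith
  have hI : ∫⁻ p, cst p ∂(θ.map (fun p => (p.1.1, p.2))) ≤
      ENNReal.ofReal (1 / s) * ∫⁻ p, cst p ∂κ' +
      ENNReal.ofReal (1 - s) * ∫⁻ p, cst p ∂(π.map ends) := by
    rw [lintegral_map measurable_cst hm1]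
    refine (lintegral_mono hpt).trans ?_
    rw [lintegral_add_left (by exact (measurable_cst.comp measurable_fst).const_mul _),
      lintegral_const_mul _ (by exact measurable_cst.comp measurable_fst),
      lintegral_const_mul _ (by exact measurable_cst.comp hm2)]
    gcongr ?_ + ?_
    · rw [← hθ1, lintegral_map measurable_cst measurable_fst]
    · rw [← lintegral_map (f := cst) measurable_cst hm2, hθ2, lintegral_map measurable_cst hse,
        lintegral_map measurable_cst measurable_ends,
        ← lintegral_const_mul _ (by exact measurable_cst.comp hse),
        ← lintegral_const_mul _ (by exact measurable_cst.comp measurable_ends)]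
      refine lintegral_mono fun γ => ?_
      unfold cst ends
      have h1s : 0 < 1 - (s : ℝ) := by linarith
      rw [← ENNReal.ofReal_mul (by positivity), ← ENNReal.ofReal_mul (by positivity)]
      apply ENNReal.ofReal_le_ofReal
      have : |((s : ℝ)) - ((1 : unitInterval) : ℝ)| = 1 - s := by
        rw [abs_sub_comm]; simp [abs_of_pos h1s]
      simp only [geo_dist γ s 1, this]
      apply le_of_eq
      field_simp
  have hfinal := key.trans hI
  rcases eq_or_ne (∫⁻ p, cst p ∂κ') ⊤ with hB | hB
  · rw [hB]; exact le_top
  have hA := h.cost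
  set A := ∫⁻ p, cst p ∂(π.map ends)
  set B := ∫⁻ p, cst p ∂κ'
  rw [← ENNReal.ofReal_toReal hA, ← ENNReal.ofReal_toReal hB] at hfinal ⊢
  have h1s : 0 < 1 - (s : ℝ) := by linarith
  have hA0 := ENNReal.toReal_nonneg (a := A)
  have hB0 := ENNReal.toReal_nonneg (a := B)
  rw [← ENNReal.ofReal_mul (by positivity), ← ENNReal.ofReal_mul (by positivity),
    ← ENNReal.ofReal_add (by positivity) (by positivity),
    ENNReal.ofReal_le_ofReal_iff (by positivity)] at hfinal
  rw [← ENNReal.ofReal_mul (by positivity)]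
  apply ENNReal.ofReal_le_ofReal
  have : (s : ℝ) * A.toReal ≤ 1 / s * B.toReal := by linarith
  calc (s : ℝ) ^ 2 * A.toReal = s * (s * A.toReal) := by ring
    _ ≤ s * (1 / s * B.toReal) := by gcongr
    _ = B.toReal := by field_simp

/-- shifted cost -/
def cstp (a : ℝ) (p : X × X) : ℝ≥0∞ := ENNReal.ofReal ((dist p.1 p.2 + a) ^ 2)

theorem measurable_cstp (a : ℝ) : Measurable (cstp a : X × X → ℝ≥0∞) := by
  unfold cstp; fun_prop

theorem push_right [Nonempty X] (κ Λ : Measure (X × X)) [IsFiniteMeasure κ] [IsFiniteMeasure Λ]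
    (h : κ.map Prod.snd = Λ.map Prod.fst) {ε : ℝ} (hε : 0 ≤ ε)
    (hd : ∀ᵐ p ∂Λ, dist p.1 p.2 ≤ ε) :
    ∃ κ' : Measure (X × X), κ'.map Prod.fst = κ.map Prod.fst ∧ κ'.map Prod.snd = Λ.map Prod.snd ∧
      ∀ a, 0 ≤ a → ∫⁻ p, cstp a p ∂κ' ≤ ∫⁻ p, cstp (a + ε) p ∂κ := by
  obtain ⟨θ, hθ1, hθ2⟩ := exists_glue κ Λ h
  have hm1 : Measurable (fun p : (X × X) × X => (p.1.1, p.2)) := by fun_prop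
  have hm2 : Measurable (fun p : (X × X) × X => (p.1.2, p.2)) := by fun_prop
  refine ⟨θ.map (fun p => (p.1.1, p.2)), ?_, ?_, fun a ha => ?_⟩
  · rw [← hθ1, Measure.map_map measurable_fst hm1,
      Measure.map_map measurable_fst measurable_fst]; rfl
  · rw [← hθ2, Measure.map_map measurable_snd hm1, Measure.map_map measurable_snd hm2]; rfl
  · rw [← hθ1, lintegral_map (measurable_cstp _) hm1, lintegral_map (measurable_cstp _) measurable_fst]
    rw [← hθ2] at hd
    have hd' := ae_of_ae_map hm2.aemeasurable hd
    apply lintegral_mono_ae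
    filter_upwards [hd'] with p hp
    unfold cstp
    apply ENNReal.ofReal_le_ofReal
    have ht := dist_triangle p.1.1 p.1.2 p.2
    have := dist_nonneg (x := p.1.1) (y := p.2)
    gcongr ?_ ^ 2
    linarith

theorem push_left [Nonempty X] (κ Λ : Measure (X × X)) [IsFiniteMeasure κ] [IsFiniteMeasure Λ]
    (h : κ.map Prod.fst = Λ.map Prod.fst) {ε : ℝ} (hε : 0 ≤ ε)
    (hd : ∀ᵐ p ∂Λ, dist p.1 p.2 ≤ ε) :
    ∃ κ' : Measure (X × X), κ'.map Prod.fst = Λ.map Prod.snd ∧ κ'.map Prod.snd = κ.map Prod.snd ∧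
      ∀ a, 0 ≤ a → ∫⁻ p, cstp a p ∂κ' ≤ ∫⁻ p, cstp (a + ε) p ∂κ := by
  have hsw : ∀ (a : ℝ) (p : X × X), cstp a p.swap = cstp a p := by
    intro a p; simp [cstp, dist_comm]
  obtain ⟨κ', h1, h2, h3⟩ := push_right (κ.map Prod.swap) Λ (by
    rw [Measure.map_map measurable_snd measurable_swap, ← h]; rfl) hε hd
  refine ⟨κ'.map Prod.swap, ?_, ?_, fun a ha => ?_⟩
  · rw [Measure.map_map measurable_fst measurable_swap, ← h2]; rfl
  · rw [Measure.map_map measurable_fst measurable_swap] at h1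
    rw [Measure.map_map measurable_snd measurable_swap]; exact h1
  · have := h3 a ha
    rw [lintegral_map (measurable_cstp _) measurable_swap] at this ⊢
    simpa [hsw] using this
end

section
variable [BorelSpace X] [ProperSpace X]

theorem OptC.of_support [Nonempty X] {π ω : Measure (Geo X)} [IsFiniteMeasure π]
    [IsFiniteMeasure ω] (h : OptC (π.map ends)) {B : Set X} (hB : IsCompact B)
    (hπ : ∀ᵐ γ ∂π, eval 0 γ ∈ B ∧ eval 1 γ ∈ B) (hω : ∀ᵐ γ ∂ω, γ ∈ π.support) :
    OptC (ω.map ends) := by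
  classical
  obtain ⟨R0, hR0⟩ := Metric.isBounded_iff.1 hB.isBounded
  set R := max R0 0 with hRdef
  have hR : ∀ x ∈ B, ∀ y ∈ B, dist x y ≤ R := fun x hx y hy =>
    (hR0 hx hy).trans (le_max_left _ _)
  have hRn : 0 ≤ R := le_max_right _ _
  have hScomp0 := geo_isCompact (Y := X) hB
  have hSsub : π.support ⊆ {γ : Geo X | eval 0 γ ∈ B ∧ eval 1 γ ∈ B} :=
    Measure.support_subset_of_isClosed hScomp0.isClosed hπ
  have hScomp : IsCompact π.support := hScomp0.of_isClosed_subset Measure.isClosed_support hSsub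
  have hωB : ∀ᵐ γ ∂ω, eval 0 γ ∈ B ∧ eval 1 γ ∈ B := hω.mono fun γ hγ => hSsub hγ
  have hcostω : ∫⁻ p, cst p ∂(ω.map ends) ≠ ⊤ := by
    rw [lintegral_map measurable_cst measurable_ends]
    refine ((lintegral_mono_ae (g := fun _ => ENNReal.ofReal (R ^ 2)) ?_).trans_lt ?_).ne
    · filter_upwards [hωB] with γ hγ
      unfold cst ends
      apply ENNReal.ofReal_le_ofReal
      have := hR _ hγ.1 _ hγ.2
      gcongr
    · rw [lintegral_const]
      exact ENNReal.mul_lt_top ENNReal.ofReal_lt_top (measure_lt_top _ _)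
  refine ⟨inferInstance, hcostω, fun κ' h1 h2 => ?_⟩
  rw [map_ends_fst] at h1
  rw [map_ends_snd] at h2
  have hκu : κ' univ = ω univ := by
    rw [← preimage_univ (f := Prod.fst), ← Measure.map_apply measurable_fst .univ, h1,
      Measure.map_apply (measurable_eval 0) .univ, preimage_univ]
  have hκfin : IsFiniteMeasure κ' := ⟨by rw [hκu]; exact measure_lt_top _ _⟩
  have hκB : ∀ᵐ p ∂κ', p.1 ∈ B ∧ p.2 ∈ B := by
    have a1 : ∀ᵐ x ∂(κ'.map Prod.fst), x ∈ B := by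
      rw [h1, ae_map_iff (p := fun x => x ∈ B) (measurable_eval 0).aemeasurable
        hB.isClosed.measurableSet]
      exact hωB.mono fun γ hγ => hγ.1
    have a2 : ∀ᵐ x ∂(κ'.map Prod.snd), x ∈ B := by
      rw [h2, ae_map_iff (p := fun x => x ∈ B) (measurable_eval 1).aemeasurable
        hB.isClosed.measurableSet]
      exact hωB.mono fun γ hγ => hγ.2
    filter_upwards [ae_of_ae_map measurable_fst.aemeasurable a1,
      ae_of_ae_map measurable_snd.aemeasurable a2] with p p1 p2 using ⟨p1, p2⟩
  have main : ∀ ε : ℝ, 0 < ε → ∫⁻ p, cst p ∂(ω.map ends) ≤ ∫⁻ p, cst p ∂κ' +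
      ENNReal.ofReal (8 * ε * R + 4 * ε ^ 2) * ω univ := by
    intro ε hε
    obtain ⟨t, htS, htf, htc⟩ := hScomp.finite_cover_balls (half_pos hε)
    obtain ⟨c, hc0, hct, hc⟩ : ∃ c : ℝ≥0∞, 0 < c ∧ c ≠ ⊤ ∧ ∀ γ ∈ π.support, c ≤ π (ball γ ε) := by
      refine ⟨min 1 (htf.toFinset.inf fun γ => π (ball γ (ε / 2))), ?_, ?_, ?_⟩
      · refine lt_min one_pos ?_
        rw [Finset.lt_inf_iff (by simp)]
        intro γ hγ
        exact (Measure.mem_support_iff_forall _).1 (htS (by simpa using hγ)) _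
          (ball_mem_nhds _ (half_pos hε))
      · exact ((min_le_left _ _).trans_lt one_lt_top).ne
      · intro γ hγ
        have := htc hγ
        simp only [mem_iUnion, exists_prop] at this
        obtain ⟨η, hη, hd⟩ := this
        refine (min_le_right _ _).trans ((Finset.inf_le (b := η) (by simpa using hη)).trans ?_)
        apply measure_mono
        intro ζ hζ
        rw [mem_ball] at hζ hd ⊢
        have := dist_triangle ζ η γ
        rw [dist_comm η γ] at this
        linarith
    let D : Set (Geo X × Geo X) := {p | dist p.1 p.2 < ε}
    have hD : MeasurableSet D := (isOpen_lt (by fun_prop) (by fun_prop)).measurableSet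
    have hsec : ∀ γ, π (Prod.mk γ ⁻¹' D) = π (ball γ ε) := by
      intro γ; congr 1; ext η; simp [D, dist_comm]
    let w : Geo X → ℝ≥0∞ := fun γ => (π (Prod.mk γ ⁻¹' D))⁻¹
    have hw : Measurable w := (measurable_measure_prodMk_left hD).inv
    let k : Geo X × Geo X → ℝ≥0∞ := D.indicator (fun p => w p.1)
    have hk : Measurable k := (hw.comp measurable_fst).indicator hD
    let Λ := (ω.prod π).withDensity k
    have hΛ1 : Λ.map Prod.fst = ω := by
      ext A hA
      rw [Measure.map_apply measurable_fst hA, withDensity_apply _ (hA.preimage measurable_fst),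
        ← lintegral_indicator (hA.preimage measurable_fst),
        lintegral_prod _ (by exact (hk.indicator (hA.preimage measurable_fst)).aemeasurable)]
      rw [← lintegral_indicator_one hA]
      apply lintegral_congr_ae
      filter_upwards [hω] with γ hγ
      have e : ∀ η, (Prod.fst ⁻¹' A).indicator k (γ, η) =
          (A.indicator 1 γ * w γ) * (Prod.mk γ ⁻¹' D).indicator 1 η := by
        intro η
        by_cases hγA : γ ∈ A <;> by_cases hd : (γ, η) ∈ D <;> simp [k, hγA, hd, Set.indicator]
      simp_rw [e]
      rw [lintegral_const_mul _ (measurable_one.indicator (measurable_prodMk_left hD)),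
        lintegral_indicator_one (measurable_prodMk_left hD), mul_assoc]
      have : w γ * π (Prod.mk γ ⁻¹' D) = 1 := by
        refine ENNReal.inv_mul_cancel ?_ (measure_ne_top _ _)
        rw [hsec]
        exact (hc0.trans_le (hc γ hγ)).ne'
      rw [this, mul_one]
    have hΛfin : IsFiniteMeasure Λ := ⟨by
      rw [← preimage_univ (f := Prod.fst), ← Measure.map_apply measurable_fst .univ, hΛ1]
      exact measure_lt_top _ _⟩
    have hΛ2 : Λ.map Prod.snd ≤ (c⁻¹ * ω univ) • π := by
      refine Measure.le_iff.2 fun A hA => ?_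
      rw [Measure.map_apply measurable_snd hA, withDensity_apply _ (hA.preimage measurable_snd),
        ← lintegral_indicator (hA.preimage measurable_snd),
        lintegral_prod _ (by exact (hk.indicator (hA.preimage measurable_snd)).aemeasurable)]
      have : ∀ᵐ γ ∂ω, ∫⁻ η, (Prod.snd ⁻¹' A).indicator k (γ, η) ∂π ≤ c⁻¹ * π A := by
        filter_upwards [hω] with γ hγ
        rw [← lintegral_indicator_one hA, ← lintegral_const_mul _ (measurable_one.indicator hA)]
        refine lintegral_mono fun η => ?_
        have hwc : w γ ≤ c⁻¹ := by
          refine ENNReal.inv_le_inv.2 ?_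
          rw [hsec]; exact hc γ hγ
        by_cases hγA : η ∈ A <;> by_cases hd : (γ, η) ∈ D <;>
          simp [k, hγA, hd, Set.indicator, hwc]
      refine (lintegral_mono_ae this).trans ?_
      rw [lintegral_const, Measure.smul_apply, smul_eq_mul]
      apply le_of_eq; ring
    have hΛD : ∀ᵐ p ∂Λ, p ∈ D := by
      rw [ae_iff]
      change Λ Dᶜ = 0
      rw [withDensity_apply _ hD.compl, setLIntegral_congr_fun hD.compl
        (g := fun _ => 0) (fun p hp => by simp only [k]; exact indicator_of_notMem hp _)]
      simp
    have hev : ∀ t : unitInterval, ∀ p ∈ D, dist (eval t p.1) (eval t p.2) ≤ ε := by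
      intro t p hp
      exact (ContinuousMap.dist_apply_le_dist t).trans (le_of_lt hp)
    let ω' := Λ.map Prod.snd
    have hω'fin : IsFiniteMeasure ω' := by infer_instance
    have hopt' : OptC (ω'.map ends) := by
      refine (h.smul (c := c⁻¹ * ω univ) ?_).mono ?_
      · exact ENNReal.mul_ne_top (ENNReal.inv_ne_top.2 hc0.ne') (measure_ne_top _ _)
      · rw [← Measure.map_smul]
        exact Measure.map_mono hΛ2 measurable_ends
    have hω'B : ∀ᵐ γ ∂ω', eval 0 γ ∈ B ∧ eval 1 γ ∈ B := by
      have : ω' ≪ π := (Measure.absolutelyContinuous_of_le hΛ2).trans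
        (Measure.smul_absolutelyContinuous)
      exact this.ae_le hπ
    -- couplings of evaluations
    let E : unitInterval → Geo X × Geo X → X × X := fun t p => (eval t p.1, eval t p.2)
    have hE : ∀ t, Measurable (E t) := fun t =>
      ((measurable_eval t).comp measurable_fst).prodMk ((measurable_eval t).comp measurable_snd)
    have hE1 : ∀ t, (Λ.map (E t)).map Prod.fst = ω.map (eval t) := by
      intro t
      rw [← hΛ1, Measure.map_map measurable_fst (hE t), Measure.map_map (measurable_eval t)
        measurable_fst]; rfl
    have hE2 : ∀ t, (Λ.map (E t)).map Prod.snd = ω'.map (eval t) := by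
      intro t
      rw [Measure.map_map measurable_snd (hE t), Measure.map_map (measurable_eval t)
        measurable_snd]; rfl
    have hEd : ∀ t, ∀ᵐ p ∂(Λ.map (E t)), dist p.1 p.2 ≤ ε := by
      intro t
      rw [ae_map_iff (hE t).aemeasurable (measurableSet_le (by fun_prop) (by fun_prop))]
      filter_upwards [hΛD] with p hp using hev t p hp
    obtain ⟨κ1, a1, a2, a3⟩ := push_left κ' (Λ.map (E 0)) (by rw [h1, hE1]) hε.le (hEd 0)
    have hκ1fin : IsFiniteMeasure κ1 := ⟨by
      rw [← preimage_univ (f := Prod.fst), ← Measure.map_apply measurable_fst .univ, a1]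
      exact measure_lt_top _ _⟩
    obtain ⟨κ2, b1, b2, b3⟩ := push_right κ1 (Λ.map (E 1)) (by rw [a2, h2, hE1]) hε.le (hEd 1)
    have o1 := hopt'.opt κ2 (by rw [b1, a1, hE2, map_ends_fst]) (by rw [b2, hE2, map_ends_snd])
    have o2 : ∫⁻ p, cst p ∂κ2 ≤ ∫⁻ p, cstp (0 + ε + ε) p ∂κ' := by
      have : ∀ p : X × X, cst p = cstp 0 p := fun p => by simp [cst, cstp]
      simp_rw [this]
      exact (b3 0 le_rfl).trans (a3 _ (by linarith))
    have o3 : ∫⁻ p, cstp (0 + ε + ε) p ∂κ' ≤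
        ∫⁻ p, cst p ∂κ' + ENNReal.ofReal (4 * ε * R + 4 * ε ^ 2) * ω univ := by
      rw [← hκu, ← lintegral_const, ← lintegral_add_right _ measurable_const]
      apply lintegral_mono_ae
      filter_upwards [hκB] with p hp
      unfold cst cstp
      rw [← ENNReal.ofReal_add (by positivity) (by positivity)]
      apply ENNReal.ofReal_le_ofReal
      have := hR _ hp.1 _ hp.2
      nlinarith [mul_nonneg hε.le (sub_nonneg.2 this)]
    have o4 : ∫⁻ p, cst p ∂(ω.map ends) ≤
        ∫⁻ p, cst p ∂(ω'.map ends) + ENNReal.ofReal (4 * ε * R) * ω univ := by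
      have hce : Measurable (fun γ : Geo X => cst (ends γ)) := measurable_cst.comp measurable_ends
      have hu : ω univ = Λ univ := by
        rw [← hΛ1, Measure.map_apply measurable_fst .univ, preimage_univ]
      rw [hu]
      conv_lhs => rw [← hΛ1]
      rw [lintegral_map measurable_cst measurable_ends,
        lintegral_map measurable_cst measurable_ends, lintegral_map hce measurable_fst,
        lintegral_map hce measurable_snd, ← lintegral_const,
        ← lintegral_add_right _ measurable_const]
      have c1 : ∀ᵐ p ∂Λ, eval 0 p.1 ∈ B ∧ eval 1 p.1 ∈ B := by
        rw [← hΛ1] at hωB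
        exact ae_of_ae_map measurable_fst.aemeasurable hωB
      have c2 : ∀ᵐ p ∂Λ, eval 0 p.2 ∈ B ∧ eval 1 p.2 ∈ B :=
        ae_of_ae_map measurable_snd.aemeasurable hω'B
      apply lintegral_mono_ae
      filter_upwards [c1, c2, hΛD] with p p1 p2 pd
      unfold cst ends
      rw [← ENNReal.ofReal_add (by positivity) (by positivity)]
      apply ENNReal.ofReal_le_ofReal
      have d0 := hev 0 p pd
      have d1 := hev 1 p pd
      have r1 := hR _ p1.1 _ p1.2
      have r2 := hR _ p2.1 _ p2.2
      have t1 := dist_triangle (eval 0 p.1) (eval 0 p.2) (eval 1 p.1)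
      have t2 := dist_triangle (eval 0 p.2) (eval 1 p.2) (eval 1 p.1)
      rw [dist_comm (eval 1 p.2)] at t2
      have n1 := dist_nonneg (x := eval 0 p.1) (y := eval 1 p.1)
      have n2 := dist_nonneg (x := eval 0 p.2) (y := eval 1 p.2)
      simp only
      nlinarith [mul_nonneg hε.le (sub_nonneg.2 r1), mul_nonneg hε.le (sub_nonneg.2 r2)]
    calc _ ≤ _ := o4
      _ ≤ (∫⁻ p, cst p ∂κ' + ENNReal.ofReal (4 * ε * R + 4 * ε ^ 2) * ω univ) +
          ENNReal.ofReal (4 * ε * R) * ω univ := by gcongr; exact o1.trans (o2.trans o3)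
      _ = _ := by
        rw [add_assoc, ← add_mul, ← ENNReal.ofReal_add (by positivity) (by positivity)]
        congr 3; ring
  have hlim : Filter.Tendsto (fun ε : ℝ => ∫⁻ p, cst p ∂κ' +
      ENNReal.ofReal (8 * ε * R + 4 * ε ^ 2) * ω univ) (nhdsWithin 0 (Ioi 0))
      (nhds (∫⁻ p, cst p ∂κ' + ENNReal.ofReal (8 * 0 * R + 4 * 0 ^ 2) * ω univ)) := by
    refine Filter.Tendsto.const_add _ (ENNReal.Tendsto.mul_const ?_ (Or.inr (measure_ne_top _ _)))
    refine ENNReal.tendsto_ofReal (Filter.Tendsto.mono_left ?_ nhdsWithin_le_nhds)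
    exact Continuous.tendsto (f := fun ε : ℝ => 8 * ε * R + 4 * ε ^ 2) (by fun_prop) 0
  have := ge_of_tendsto hlim (Filter.eventually_of_mem self_mem_nhdsWithin fun ε hε => main ε hε)
  simpa using this
end

section
theorem sinh_mul_le {t x : ℝ} (ht0 : 0 ≤ t) (ht1 : t ≤ 1) (hx : 0 ≤ x) :
    Real.sinh (t * x) ≤ t * Real.sinh x := by
  have hconv : ConvexOn ℝ (Ici (0 : ℝ)) Real.sinh := by
    apply MonotoneOn.convexOn_of_deriv (convex_Ici 0) Real.continuous_sinh.continuousOn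
      Real.differentiable_sinh.differentiableOn
    rw [Real.deriv_sinh]
    intro a ha b hb hab
    rw [interior_Ici, mem_Ioi] at ha hb
    rw [Real.cosh_le_cosh, abs_of_pos ha, abs_of_pos hb]; exact hab
  have := hconv.2 (by simp : (0 : ℝ) ∈ Ici (0 : ℝ)) (mem_Ici.2 hx)
    (by linarith : 0 ≤ 1 - t) ht0 (by ring)
  simpa using this

theorem sin_mul_ge {t x : ℝ} (ht0 : 0 ≤ t) (ht1 : t ≤ 1) (hx : 0 ≤ x) (hx' : x ≤ Real.pi) :
    t * Real.sin x ≤ Real.sin (t * x) := by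
  have := strictConcaveOn_sin_Icc.concaveOn.2 (⟨le_rfl, Real.pi_pos.le⟩ : (0 : ℝ) ∈ Icc 0 Real.pi)
    (⟨hx, hx'⟩ : x ∈ Icc 0 Real.pi) (by linarith : 0 ≤ 1 - t) ht0 (by ring)
  simpa using this

theorem measurable_sigmaCoeff (K N t : ℝ) : Measurable (fun θ => sigmaCoeff K N t θ) := by
  unfold sigmaCoeff
  refine Measurable.ite (measurableSet_le (by fun_prop) (by fun_prop)) measurable_const ?_
  refine Measurable.ite (measurableSet_lt (by fun_prop) (by fun_prop)) (by fun_prop) ?_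
  refine Measurable.ite (measurableSet_eq_fun (by fun_prop) (by fun_prop)) (by fun_prop) ?_
  have : Measurable Real.sinh := Real.continuous_sinh.measurable
  fun_prop

theorem sigma_aux {K N θ : ℝ} (hN : 0 < N) (hθ : 0 ≤ θ)
    (h1 : ¬ N * Real.pi ^ 2 ≤ K * θ ^ 2) (h2 : 0 < K * θ ^ 2) :
    0 < θ * Real.sqrt (K / N) ∧ θ * Real.sqrt (K / N) < Real.pi := by
  have hθ' : 0 < θ := by
    rcases hθ.eq_or_lt with h | h
    · subst h; simp at h2
    · exact h
  have hK : 0 < K := by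
    by_contra h
    have := mul_nonneg (sq_nonneg θ) (neg_nonneg.2 (not_lt.1 h))
    linarith
  have hs : 0 < Real.sqrt (K / N) := Real.sqrt_pos.2 (by positivity)
  refine ⟨by positivity, ?_⟩
  apply lt_of_pow_lt_pow_left₀ 2 Real.pi_pos.le
  rw [mul_pow, Real.sq_sqrt (by positivity)]
  rw [not_le] at h1
  calc θ ^ 2 * (K / N) = (K * θ ^ 2) / N := by ring
    _ < (N * Real.pi ^ 2) / N := by gcongr
    _ = Real.pi ^ 2 := by field_simp

theorem sigma_aux2 {K N θ : ℝ} (hN : 0 < N) (hθ : 0 ≤ θ)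
    (h2 : ¬ 0 < K * θ ^ 2) (h3 : ¬ K * θ ^ 2 = 0) :
    0 < θ * Real.sqrt (-K / N) ∧ K < 0 := by
  have hθ' : 0 < θ := by
    rcases hθ.eq_or_lt with h | h
    · subst h; simp at h3
    · exact h
  have hK : K < 0 := by
    by_contra h
    have := mul_nonneg (sq_nonneg θ) (not_lt.1 h)
    apply h3
    linarith
  have : 0 < -K := by linarith
  exact ⟨mul_pos hθ' (Real.sqrt_pos.2 (by positivity)), hK⟩

theorem sigma_pos {K N t θ : ℝ} (hN : 0 < N) (ht0 : 0 < t) (ht1 : t ≤ 1) (hθ : 0 ≤ θ) :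
    0 < sigmaCoeff K N t θ := by
  unfold sigmaCoeff
  split_ifs with h1 h2 h3
  · simp
  · obtain ⟨a, b⟩ := sigma_aux hN hθ h1 h2
    rw [mul_assoc]
    apply ENNReal.ofReal_pos.2
    apply div_pos _ (Real.sin_pos_of_pos_of_lt_pi a b)
    apply Real.sin_pos_of_pos_of_lt_pi (by positivity)
    nlinarith
  · simpa using ht0
  · obtain ⟨a, b⟩ := sigma_aux2 hN hθ h2 h3
    rw [mul_assoc]
    apply ENNReal.ofReal_pos.2
    have hx : 0 < t * (θ * √(-K / N)) := by positivity
    exact div_pos (Real.sinh_pos_iff.2 hx) (Real.sinh_pos_iff.2 a)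

theorem sigma_lower {K N t θ R : ℝ} (hN : 0 < N) (ht0 : 0 ≤ t) (ht1 : t ≤ 1) (hθ : 0 ≤ θ)
    (hθR : θ ≤ R) :
    ENNReal.ofReal (1 - t * Real.cosh (R * Real.sqrt (|K| / N))) ≤ sigmaCoeff K N (1 - t) θ := by
  set C := Real.cosh (R * Real.sqrt (|K| / N))
  have hC : 1 ≤ C := Real.one_le_cosh _
  have hC' : 1 - t * C ≤ 1 - t := by nlinarith
  unfold sigmaCoeff
  split_ifs with h1 h2 h3
  · simp
  · obtain ⟨a, b⟩ := sigma_aux hN hθ h1 h2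
    rw [mul_assoc]
    apply ENNReal.ofReal_le_ofReal
    have hs := Real.sin_pos_of_pos_of_lt_pi a b
    rw [le_div_iff₀ hs]
    have := sin_mul_ge (t := 1 - t) (by linarith) (by linarith) a.le b.le
    nlinarith
  · exact ENNReal.ofReal_le_ofReal hC'
  · obtain ⟨a, b⟩ := sigma_aux2 hN hθ h2 h3
    rw [mul_assoc]
    apply ENNReal.ofReal_le_ofReal
    have hCx : Real.cosh (θ * √(-K / N)) ≤ C := by
      simp only [C]
      rw [Real.cosh_le_cosh, abs_of_neg b, abs_of_pos a, abs_of_nonneg (by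
        have := hθ.trans hθR
        positivity)]
      gcongr
    set x := θ * √(-K / N)
    have hs : 0 < Real.sinh x := Real.sinh_pos_iff.2 a
    rw [le_div_iff₀ hs]
    have e : (1 - t) * x = x - t * x := by ring
    rw [e, Real.sinh_sub]
    have i1 := sinh_mul_le ht0 ht1 a.le
    have i2 := Real.one_le_cosh (t * x)
    have i3 := Real.cosh_pos x
    have i4 : Real.cosh x * Real.sinh (t * x) ≤ C * (t * Real.sinh x) := by
      have : 0 ≤ t * Real.sinh x := by positivity
      calc _ ≤ Real.cosh x * (t * Real.sinh x) := by gcongr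
        _ ≤ _ := by gcongr
    nlinarith
end

/-- the CD inequality at time `t` -/
def CDineq (K N' : ℝ) (m : Measure X) (π : Measure (Geo X)) (t : unitInterval) : Prop :=
  ∫⁻ γ, (sigmaCoeff K N' (1 - (t : ℝ)) (dist (eval 0 γ) (eval 1 γ)) *
                 ((π.map (eval 0)).rnDeriv m (eval 0 γ)) ^ (-(1 / N')) +
               sigmaCoeff K N' (t : ℝ) (dist (eval 0 γ) (eval 1 γ)) *
                 ((π.map (eval 1)).rnDeriv m (eval 1 γ)) ^ (-(1 / N'))) ∂π
          ≤ ∫⁻ x, ((π.map (eval t)).rnDeriv m x) ^ (1 - 1 / N') ∂m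

section
variable [BorelSpace X] [ProperSpace X]

theorem CDineq.left {K N' : ℝ} {m : Measure X} {π : Measure (Geo X)} {t : unitInterval}
    (h : CDineq K N' m π t) :
    ∫⁻ γ, (sigmaCoeff K N' (1 - (t : ℝ)) (dist (eval 0 γ) (eval 1 γ)) *
                 ((π.map (eval 0)).rnDeriv m (eval 0 γ)) ^ (-(1 / N'))) ∂π
          ≤ ∫⁻ x, ((π.map (eval t)).rnDeriv m x) ^ (1 - 1 / N') ∂m :=
  (lintegral_mono fun _ => le_self_add).trans h

theorem CDineq.not_singular {K N' : ℝ} (hN : 1 < N') {m : Measure X} [SigmaFinite m]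
    {π : Measure (Geo X)}
    [IsProbabilityMeasure π] {t : unitInterval} (h : CDineq K N' m π t) (ht : (t : ℝ) < 1)
    (h0 : π.map (eval 0) ≪ m) : ¬ (π.map (eval t)) ⟂ₘ m := by
  intro hs
  have h1 := h.left
  have hr : ∫⁻ x, ((π.map (eval t)).rnDeriv m x) ^ (1 - 1 / N') ∂m = 0 := by
    rw [lintegral_congr_ae (g := fun _ => 0)]
    · simp
    · filter_upwards [Measure.rnDeriv_eq_zero _ _ |>.2 hs] with x hx
      rw [hx]
      have : 0 < 1 - 1 / N' := by
        rw [sub_pos, div_lt_one (by linarith)]; exact hN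
      rw [Pi.zero_apply, ENNReal.zero_rpow_of_pos this]
  rw [hr, nonpos_iff_eq_zero, lintegral_eq_zero_iff] at h1
  · have hae : ∀ᵐ γ ∂π, (π.map (eval 0)).rnDeriv m (eval 0 γ) < ⊤ :=
      ae_of_ae_map (measurable_eval 0).aemeasurable (h0.ae_le (Measure.rnDeriv_lt_top _ _))
    have : ∀ᵐ γ ∂π, False := by
      filter_upwards [h1, hae] with γ g1 g2
      simp only [Pi.zero_apply, mul_eq_zero] at g1
      rcases g1 with g1 | g1
      · exact (sigma_pos (by linarith) (by linarith) (by linarith [t.2.1]) dist_nonneg).ne' g1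
      · rw [ENNReal.rpow_eq_zero_iff] at g1
        rcases g1 with g1 | g1
        · have : 0 < 1 / N' := by
            have : 0 < N' := by linarith
            positivity
          linarith [g1.2]
        · exact g2.ne g1.1
    obtain ⟨γ, hγ⟩ := this.exists
    exact hγ
  · refine Measurable.mul ((measurable_sigmaCoeff _ _ _).comp ?_) ?_
    · exact (measurable_eval 0).dist (measurable_eval 1)
    · exact ((Measure.measurable_rnDeriv _ _).comp (measurable_eval 0)).pow_const _

theorem CDineq.lower {K N' : ℝ} (hN : 1 < N') {m : Measure X} [SigmaFinite m]
    {π : Measure (Geo X)}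
    [IsProbabilityMeasure π] {t : unitInterval} (h : CDineq K N' m π t)
    {D : Set X} (hD : MeasurableSet D) (hD0 : m D ≠ 0) (hDt : m D ≠ ⊤)
    (h0 : π.map (eval 0) = (m D)⁻¹ • m.restrict D) {R : ℝ}
    (hR : ∀ᵐ γ ∂π, dist (eval 0 γ) (eval 1 γ) ≤ R) :
    ENNReal.ofReal (1 - t * Real.cosh (R * Real.sqrt (|K| / N'))) ^ N' * m D ≤
      m {x | (π.map (eval t)).rnDeriv m x ≠ 0} := by
  have hN0 : 0 < N' := by linarith
  have h1 := h.left
  set a := ENNReal.ofReal (1 - t * Real.cosh (R * Real.sqrt (|K| / N'))) with ha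
  have hfinD : IsFiniteMeasure (m.restrict D) := ⟨by simpa using hDt.lt_top⟩
  have hl : a * (m D) ^ (1 / N') ≤ ∫⁻ γ, (sigmaCoeff K N' (1 - (t : ℝ)) (dist (eval 0 γ) (eval 1 γ)) *
                 ((π.map (eval 0)).rnDeriv m (eval 0 γ)) ^ (-(1 / N'))) ∂π := by
    have e : a * (m D) ^ (1 / N') = ∫⁻ γ, a * (m D) ^ (1 / N') ∂π := by simp
    rw [e]
    apply lintegral_mono_ae
    have hae : ∀ᵐ x ∂(π.map (eval 0)), (π.map (eval 0)).rnDeriv m x = (m D)⁻¹ := by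
      have hDD : ∀ᵐ x ∂(π.map (eval 0)), x ∈ D := by
        rw [h0]
        exact Measure.ae_smul_measure (ae_restrict_mem hD) _
      have hac : π.map (eval 0) ≪ m := by
        rw [h0]
        exact (Measure.smul_absolutelyContinuous).trans Measure.restrict_le_self.absolutelyContinuous
      have e1 := Measure.rnDeriv_smul_left_of_ne_top (m.restrict D) m
        (r := (m D)⁻¹) (ENNReal.inv_ne_top.2 hD0)
      have e2 := Measure.rnDeriv_restrict_self m hD
      filter_upwards [hDD, hac.ae_le e1, hac.ae_le e2] with x x1 x2 x3
      rw [h0, x2, Pi.smul_apply, x3]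
      simp [x1]
    filter_upwards [ae_of_ae_map (measurable_eval 0).aemeasurable hae, hR] with γ g1 g2
    rw [g1]
    gcongr ?_ * ?_
    · exact sigma_lower hN0 t.2.1 t.2.2 dist_nonneg g2
    · rw [ENNReal.inv_rpow, ENNReal.rpow_neg, inv_inv]
  set ρ := (π.map (eval t)).rnDeriv m with hρ
  have hρm : Measurable ρ := Measure.measurable_rnDeriv _ _
  have hE : MeasurableSet {x | ρ x ≠ 0} := (measurableSet_eq_fun hρm measurable_const).compl
  have hr : ∫⁻ x, ρ x ^ (1 - 1 / N') ∂m ≤ (m {x | ρ x ≠ 0}) ^ (1 / N') := by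
    have hp : 0 < 1 - 1 / N' := by
      rw [sub_pos, div_lt_one (by linarith)]; exact hN
    have hq : 0 < 1 / N' := by positivity
    calc ∫⁻ x, ρ x ^ (1 - 1 / N') ∂m
        = ∫⁻ x, ρ x ^ (1 - 1 / N') * ({x | ρ x ≠ 0}.indicator 1 x) ^ (1 / N') ∂m := by
          apply lintegral_congr
          intro x
          by_cases hx : ρ x = 0
          · rw [hx, ENNReal.zero_rpow_of_pos hp, zero_mul]
          · simp [hx]
      _ ≤ (∫⁻ x, ρ x ∂m) ^ (1 - 1 / N') * (∫⁻ x, {x | ρ x ≠ 0}.indicator 1 x ∂m) ^ (1 / N') :=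
          ENNReal.lintegral_mul_norm_pow_le hρm.aemeasurable
            (measurable_one.indicator hE).aemeasurable hp.le hq.le (by ring)
      _ ≤ 1 ^ (1 - 1 / N') * (m {x | ρ x ≠ 0}) ^ (1 / N') := by
          rw [lintegral_indicator_one hE]
          gcongr
          refine Measure.lintegral_rnDeriv_le.trans ?_
          rw [Measure.map_apply (measurable_eval t) .univ]; simp
      _ = _ := by simp
  have := hl.trans (h1.trans hr)
  have h3 := ENNReal.rpow_le_rpow this hN0.le
  rwa [ENNReal.mul_rpow_of_nonneg _ _ hN0.le, ← ENNReal.rpow_mul, ← ENNReal.rpow_mul,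
    one_div_mul_cancel hN0.ne', ENNReal.rpow_one, ENNReal.rpow_one] at h3
end

/-- standing assumptions -/
structure Setup (m : Measure X) (K N : ℝ) : Prop where
  hX : IsGeodesicSpace X
  bdd : ∀ s : Set X, Bornology.IsBounded s → m s ≠ ⊤
  hN : 1 ≤ N
  hCD : IsCDStar K N m
  hGT : GoodTransport m

theorem ae_of_map_ae {Y Z : Type*} [MeasurableSpace Y] [MeasurableSpace Z] {μ : Measure Y}
    {f : Y → Z} (hf : Measurable f) {B : Set Z} (hB : MeasurableSet B) :
    (∀ᵐ z ∂(μ.map f), z ∈ B) ↔ ∀ᵐ y ∂μ, f y ∈ B :=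
  ae_map_iff (p := fun z => z ∈ B) hf.aemeasurable hB

theorem reweight {Z Y : Type*} [MeasurableSpace Z] [MeasurableSpace Y] {m : Measure Y}
    [SigmaFinite m] {π : Measure Z} [IsFiniteMeasure π] {e : Z → Y} (he : Measurable e)
    (hac : π.map e ≪ m) {D : Set Y} (hD : MeasurableSet D) {c : ℝ≥0∞}
    (hDc : ∀ x ∈ D, c ≤ (π.map e).rnDeriv m x) (hc0 : c ≠ 0) :
    ∃ π' : Measure Z, π' ≤ c⁻¹ • π ∧ π'.map e = m.restrict D := by
  set h := (π.map e).rnDeriv m with hh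
  have hm : Measurable h := Measure.measurable_rnDeriv _ _
  let f : Y → ℝ≥0∞ := D.indicator (fun x => (h x)⁻¹)
  have hf : Measurable f := hm.inv.indicator hD
  refine ⟨π.withDensity (f ∘ e), ?_, ?_⟩
  · rw [← withDensity_const]
    refine withDensity_mono (Filter.Eventually.of_forall fun z => ?_)
    simp only [Function.comp, f]
    by_cases hz : e z ∈ D
    · rw [indicator_of_mem hz]
      exact ENNReal.inv_le_inv.2 (hDc _ hz)
    · rw [indicator_of_notMem hz]; exact zero_le
  · have h1 : (π.withDensity (f ∘ e)).map e = (π.map e).withDensity f := by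
      ext A hA
      rw [Measure.map_apply he hA, withDensity_apply _ (he hA), withDensity_apply _ hA,
        setLIntegral_map hA hf he]; rfl
    rw [h1, ← Measure.withDensity_rnDeriv_eq _ _ hac, ← withDensity_mul _ hm hf,
      ← withDensity_indicator_one hD]
    apply withDensity_congr_ae
    filter_upwards [Measure.rnDeriv_lt_top (π.map e) m] with x hx
    simp only [Pi.mul_apply, f]
    by_cases hxD : x ∈ D
    · rw [indicator_of_mem hxD, indicator_of_mem hxD]
      exact ENNReal.mul_inv_cancel (fun h0 => hc0 (le_antisymm ((hDc x hxD).trans h0.le) zero_le))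
        hx.ne
    · simp [hxD]

section
variable [BorelSpace X] [ProperSpace X] 

theorem exists_compact_lower {m : Measure X} [IsLocallyFiniteMeasure m] {h : X → ℝ≥0∞}
    (hh : Measurable h) {D : Set X} (hD : MeasurableSet D) (hI : ∫⁻ x in D, h x ∂m ≠ 0) :
    ∃ c : ℝ≥0∞, c ≠ 0 ∧ c ≠ ⊤ ∧ ∃ D' ⊆ D, IsCompact D' ∧ m D' ≠ 0 ∧ ∀ x ∈ D', c ≤ h x := by
  by_contra hcon
  push Not at hcon
  apply hI
  rw [lintegral_eq_zero_iff hh]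
  have key : ∀ n : ℕ, m (D ∩ {x | ((n : ℝ≥0∞) + 1)⁻¹ ≤ h x}) = 0 := by
    intro n
    by_contra hne
    have hms : MeasurableSet (D ∩ {x | ((n : ℝ≥0∞) + 1)⁻¹ ≤ h x}) :=
      hD.inter (measurableSet_le measurable_const hh)
    obtain ⟨D', hD', hc, hpos⟩ := hms.exists_lt_isCompact (pos_iff_ne_zero.2 hne)
    obtain ⟨x, hx, hlt⟩ := hcon ((n : ℝ≥0∞) + 1)⁻¹ (by simp) (by simp) D'
      (hD'.trans inter_subset_left) hc hpos.ne'
    exact absurd (hD' hx).2 (not_le.2 hlt)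
  rw [Filter.EventuallyEq, ae_restrict_iff' hD]
  have := ae_all_iff.2 (fun n => (measure_eq_zero_iff_ae_notMem.1 (key n)))
  filter_upwards [this] with x hx hxD
  by_contra h0
  obtain ⟨n, hn⟩ := ENNReal.exists_inv_nat_lt h0
  apply hx n
  refine ⟨hxD, ?_⟩
  refine le_trans ?_ hn.le
  rw [ENNReal.inv_le_inv]
  exact le_self_add

theorem Setup.locFin {m : Measure X} {K N : ℝ} (S : Setup m K N) : IsLocallyFiniteMeasure m :=
  ⟨fun x => ⟨ball x 1, ball_mem_nhds _ one_pos, (S.bdd _ isBounded_ball).lt_top⟩⟩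

theorem exists_ac_set {m lam : Measure X} [SigmaFinite m] [IsFiniteMeasure lam] (h : ¬ lam ⟂ₘ m) :
    ∃ A, MeasurableSet A ∧ lam A ≠ 0 ∧ lam.restrict A ≪ m := by
  have hs := Measure.mutuallySingular_singularPart lam m
  refine ⟨hs.nullSet, hs.measurableSet_nullSet, fun h0 => h ?_, ?_⟩
  · exact ⟨hs.nullSet, hs.measurableSet_nullSet, h0, hs.measure_compl_nullSet⟩
  · refine Measure.AbsolutelyContinuous.mk fun E hE hE0 => ?_
    rw [Measure.restrict_apply hE]
    have a : (lam.singularPart m) (E ∩ hs.nullSet) = 0 :=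
      measure_mono_null inter_subset_right hs.measure_nullSet
    have b : (m.withDensity (lam.rnDeriv m)) (E ∩ hs.nullSet) = 0 :=
      measure_mono_null inter_subset_left (withDensity_absolutelyContinuous _ _ hE0)
    have e : lam (E ∩ hs.nullSet) = (lam.singularPart m + m.withDensity (lam.rnDeriv m))
        (E ∩ hs.nullSet) := congrArg (fun τ : Measure X => τ (E ∩ hs.nullSet))
          (Measure.haveLebesgueDecomposition_add lam m)
    rw [e, Measure.add_apply, a, b, add_zero]

theorem Setup.lemmaG {m : Measure X} {K N : ℝ} (S : Setup m K N) [IsLocallyFiniteMeasure m]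
    {κ : Measure (X × X)} (hκ : OptC κ) {D : Set X} (hDc : IsCompact D) (hD0 : m D ≠ 0)
    (h1 : κ.map Prod.fst = m.restrict D) {B : Set X} (hB : IsCompact B)
    (h2 : ∀ᵐ p ∂κ, p.2 ∈ B) {s : unitInterval} (hs : (s : ℝ) < 1) :
    ∃ D' ⊆ D, IsCompact D' ∧ m D' ≠ 0 ∧ ∃ π : Measure (Geo X), π.map (eval 0) = m.restrict D' ∧
      π.map (eval s) ≪ m ∧ (∀ᵐ γ ∂π, eval 1 γ ∈ B) ∧
      ∀ κ2, OptC (κ + κ2) → OptC (π.map ends + κ2) := by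
  have hκf := hκ.fin
  have hDt : m D ≠ ⊤ := hDc.measure_lt_top.ne
  set c := m D with hc
  have hci : c⁻¹ ≠ ⊤ := ENNReal.inv_ne_top.2 hD0
  have hci0 : c⁻¹ ≠ 0 := ENNReal.inv_ne_zero.2 hDt
  have hκu : κ univ = c := by
    rw [← preimage_univ (f := Prod.fst), ← Measure.map_apply measurable_fst .univ, h1]; simp [hc]
  have hp0 : IsProbabilityMeasure (c⁻¹ • m.restrict D) := ⟨by
    simp [← hc, ENNReal.inv_mul_cancel hD0 hDt]⟩
  have hp1 : IsProbabilityMeasure (c⁻¹ • κ.map Prod.snd) := ⟨by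
    rw [Measure.smul_apply, Measure.map_apply measurable_snd .univ, preimage_univ, hκu, smul_eq_mul,
      ENNReal.inv_mul_cancel hD0 hDt]⟩
  have h2' : ∀ᵐ x ∂(κ.map Prod.snd), x ∈ B :=
    (ae_of_map_ae measurable_snd hB.isClosed.measurableSet).2 h2
  obtain ⟨π, hopt, hineq⟩ := S.hCD _ _ hp0 hp1 ⟨D ∪ B, hDc.isBounded.union hB.isBounded, by
    refine Measure.ae_smul_measure (p := fun x => x ∈ D ∪ B) ?_ _
    exact (ae_restrict_mem hDc.isClosed.measurableSet).mono fun x hx => Or.inl hx, by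
    refine Measure.ae_smul_measure (p := fun x => x ∈ D ∪ B) ?_ _
    exact h2'.mono fun x hx => Or.inr hx⟩
  obtain ⟨hπp, e0, e1, hmin⟩ := hopt
  have hN := S.hN
  have hI : CDineq K (N + 1) m π s := hineq s (N + 1) (by linarith)
  have hac0 : π.map (eval 0) ≪ m := by
    rw [e0]
    exact (Measure.smul_absolutelyContinuous).trans Measure.restrict_le_self.absolutelyContinuous
  have hns := hI.not_singular (by linarith) hs hac0
  -- comparison of costs
  have hcost : ∫⁻ p, cst p ∂(c • π.map ends) ≤ ∫⁻ p, cst p ∂κ := by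
    obtain ⟨g, hg, hgp⟩ := exists_geo_selection S.hX
    have hge : ends ∘ g = id := by
      ext p
      · exact (hgp p).1
      · exact (hgp p).2
    have hge' : ((c⁻¹ • κ).map g).map ends = c⁻¹ • κ := by
      rw [Measure.map_map measurable_ends hg, hge, Measure.map_id]
    have := hmin ((c⁻¹ • κ).map g) ?_ ?_ ?_
    · rw [← lint_ends, ← lint_ends, hge', lintegral_smul_measure] at this
      rw [lintegral_smul_measure]
      calc c • ∫⁻ p, cst p ∂(π.map ends) ≤ c • (c⁻¹ • ∫⁻ p, cst p ∂κ) := by gcongr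
        _ = _ := by rw [smul_smul, ENNReal.mul_inv_cancel hD0 hDt, one_smul]
    · constructor
      rw [Measure.map_apply hg .univ, preimage_univ, Measure.smul_apply, hκu, smul_eq_mul,
        ENNReal.inv_mul_cancel hD0 hDt]
    · rw [← map_ends_fst, hge', Measure.map_smul, h1]
    · rw [← map_ends_snd, hge', Measure.map_smul]
  have hcopt : ∀ κ2, OptC (κ + κ2) → OptC (c • π.map ends + κ2) := by
    intro κ2 h
    refine h.of_same ?_ ?_ ?_
    · rw [Measure.map_add _ _ measurable_fst, Measure.map_add _ _ measurable_fst, Measure.map_smul,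
        map_ends_fst, e0, smul_smul, ENNReal.mul_inv_cancel hD0 hDt, one_smul, h1]
    · rw [Measure.map_add _ _ measurable_snd, Measure.map_add _ _ measurable_snd, Measure.map_smul,
        map_ends_snd, e1, smul_smul, ENNReal.mul_inv_cancel hD0 hDt, one_smul]
    · rw [lintegral_add_measure, lintegral_add_measure]
      gcongr
  obtain ⟨A, hA, hA0, hAac⟩ := exists_ac_set hns
  set πΓ := π.restrict (eval s ⁻¹' A) with hπΓ
  have hle : πΓ ≤ π := Measure.restrict_le_self
  have hac1 : πΓ.map (eval 0) ≪ m :=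
    (Measure.absolutelyContinuous_of_le (Measure.map_mono hle (measurable_eval 0))).trans hac0
  have hI2 : ∫⁻ x in D, (πΓ.map (eval 0)).rnDeriv m x ∂m ≠ 0 := by
    rw [Measure.setLIntegral_rnDeriv hac1]
    intro hz
    apply hA0
    rw [Measure.map_apply (measurable_eval 0) hDc.isClosed.measurableSet] at hz
    have hDD : ∀ᵐ γ ∂πΓ, eval 0 γ ∈ D := by
      refine (Measure.absolutelyContinuous_of_le hle).ae_le ?_
      refine (ae_of_map_ae (measurable_eval 0) hDc.isClosed.measurableSet).1 ?_
      rw [e0]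
      exact Measure.ae_smul_measure (ae_restrict_mem hDc.isClosed.measurableSet) _
    have hu : πΓ univ = 0 := by
      rw [← measure_add_measure_compl ((measurable_eval 0) hDc.isClosed.measurableSet)
        (μ := πΓ), hz, zero_add]
      exact hDD
    rw [Measure.map_apply (measurable_eval s) hA]
    simpa [hπΓ] using hu
  obtain ⟨c', hc'0, hc't, D', hD'D, hD'c, hD'0, hlow⟩ :=
    exists_compact_lower (Measure.measurable_rnDeriv _ _) hDc.isClosed.measurableSet hI2
  obtain ⟨π', hπ'le, hπ'0⟩ := reweight (measurable_eval 0) hac1 hD'c.isClosed.measurableSet hlow hc'0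
  have hc'i : c'⁻¹ ≠ ⊤ := ENNReal.inv_ne_top.2 hc'0
  have hπ'π : π' ≤ c'⁻¹ • π := hπ'le.trans (by gcongr)
  refine ⟨D', hD'D, hD'c, hD'0, π', hπ'0, ?_, ?_, ?_⟩
  · have : π'.map (eval s) ≤ c'⁻¹ • (π.map (eval s)).restrict A := by
      rw [Measure.restrict_map (measurable_eval s) hA, ← Measure.map_smul]
      exact Measure.map_mono hπ'le (measurable_eval s)
    exact (Measure.absolutelyContinuous_of_le this).trans
      ((Measure.smul_absolutelyContinuous).trans hAac)
  · have : π' ≪ π := (Measure.absolutelyContinuous_of_le hπ'π).trans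
      Measure.smul_absolutelyContinuous
    refine this.ae_le ((ae_of_map_ae (measurable_eval 1) hB.isClosed.measurableSet).1 ?_)
    rw [e1]
    exact Measure.ae_smul_measure h2' _
  · intro κ2 h
    refine ((hcopt κ2 h).smul (c := 1 + c'⁻¹ * c⁻¹) ?_).mono ?_
    · exact ENNReal.add_ne_top.2 ⟨one_ne_top, ENNReal.mul_ne_top hc'i hci⟩
    · rw [smul_add]
      gcongr ?_ + ?_
      · calc π'.map ends ≤ (c'⁻¹ • π).map ends := Measure.map_mono hπ'π measurable_ends
          _ = (c'⁻¹ * c⁻¹) • (c • π.map ends) := by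
            rw [Measure.map_smul, smul_smul, mul_assoc, ENNReal.inv_mul_cancel hD0 hDt, mul_one]
          _ ≤ _ := by gcongr; exact le_add_self
      · rw [add_smul, one_smul]; exact Measure.le_add_right le_rfl
end

section
variable {Y : Type*} [MetricSpace Y]

/-- reversed geodesic -/
def rev (γ : Geo Y) : Geo Y :=
  ⟨γ.1.comp ⟨unitInterval.symm, unitInterval.continuous_symm⟩, by
    intro a b
    have h := γ.2
    simp only [ContinuousMap.comp_apply, ContinuousMap.coe_mk]
    rw [h, unitInterval.symm_zero, unitInterval.symm_one, dist_comm (γ.1 1) (γ.1 0)]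
    congr 1
    rw [unitInterval.coe_symm_eq, unitInterval.coe_symm_eq, ← abs_neg]
    congr 1
    ring⟩

@[simp] theorem eval_rev (t : unitInterval) (γ : Geo Y) : eval t (rev γ) = eval (unitInterval.symm t) γ := rfl

theorem rev_continuous : Continuous (rev : Geo Y → Geo Y) := by
  refine Continuous.subtype_mk ?_ _
  exact (ContinuousMap.continuous_precomp _).comp continuous_subtype_val
end

section
variable [BorelSpace X] [ProperSpace X]

theorem measurable_rev : Measurable (rev : Geo X → Geo X) := rev_continuous.measurable
theorem measurable_restr (s : unitInterval) : Measurable (restr s : Geo X → Geo X) :=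
  (restr_continuous s).measurable

theorem OptC.swap {κ : Measure (X × X)} (h : OptC κ) : OptC (κ.map Prod.swap) := by
  have := h.fin
  have hc : ∀ τ : Measure (X × X), ∫⁻ p, cst p ∂(τ.map Prod.swap) = ∫⁻ p, cst p ∂τ := by
    intro τ
    rw [lintegral_map measurable_cst measurable_swap]
    apply lintegral_congr
    intro p
    simp [cst, dist_comm]
  have h1 : ∀ τ : Measure (X × X), (τ.map Prod.swap).map Prod.fst = τ.map Prod.snd := by
    intro τ; rw [Measure.map_map measurable_fst measurable_swap]; rfl
  have h2 : ∀ τ : Measure (X × X), (τ.map Prod.swap).map Prod.snd = τ.map Prod.fst := by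
    intro τ; rw [Measure.map_map measurable_snd measurable_swap]; rfl
  refine ⟨inferInstance, by rw [hc]; exact h.cost, fun κ' a b => ?_⟩
  rw [hc, ← hc κ']
  refine h.opt _ ?_ ?_
  · rw [h1, b, h2]
  · rw [h2, a, h1]

theorem OptC.rev {π : Measure (Geo X)} (h : OptC (π.map ends)) : OptC ((π.map rev).map ends) := by
  have := h.swap
  rw [Measure.map_map measurable_swap measurable_ends] at this
  rw [Measure.map_map measurable_ends measurable_rev]
  convert this using 2
  ext γ <;> simp [ends]

theorem moment_of_bdd {μ : Measure X} [IsFiniteMeasure μ] {x₀ : X} {R : ℝ}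
    (h : ∀ᵐ x ∂μ, x ∈ closedBall x₀ R) : HasFiniteSecondMoment μ := by
  refine ⟨x₀, ((lintegral_mono_ae (g := fun _ => ENNReal.ofReal (R ^ 2)) ?_).trans_lt ?_).ne⟩
  · filter_upwards [h] with x hx
    apply ENNReal.ofReal_le_ofReal
    have := mem_closedBall.1 hx
    gcongr
  · rw [lintegral_const]
    exact ENNReal.mul_lt_top ENNReal.ofReal_lt_top (measure_lt_top _ _)

/-- all geodesics stay in a ball -/
def Bd (x₀ : X) (R : ℝ) (π : Measure (Geo X)) : Prop := ∀ᵐ γ ∂π, ∀ t, eval t γ ∈ closedBall x₀ R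

theorem measurableSet_bd (x₀ : X) (R : ℝ) :
    MeasurableSet {γ : Geo X | ∀ t, eval t γ ∈ closedBall x₀ R} := by
  have : {γ : Geo X | ∀ t, eval t γ ∈ closedBall x₀ R} =
      ⋂ t, eval t ⁻¹' (closedBall x₀ R) := by ext γ; simp
  rw [this]
  exact (isClosed_iInter fun t => isClosed_closedBall.preimage (geo_eval_continuous t)).measurableSet

theorem Bd.ac {x₀ : X} {R : ℝ} {π π' : Measure (Geo X)} (h : Bd x₀ R π) (hac : π' ≪ π) :
    Bd x₀ R π' := hac.ae_le h

theorem Bd.map {x₀ : X} {R : ℝ} {π : Measure (Geo X)} (h : Bd x₀ R π) {f : Geo X → Geo X}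
    (hf : Measurable f) (hfe : ∀ γ t, ∃ t', eval t (f γ) = eval t' γ) : Bd x₀ R (π.map f) := by
  refine (ae_of_map_ae hf (measurableSet_bd x₀ R)).2 ?_
  refine Filter.Eventually.mono h fun γ hγ t => ?_
  obtain ⟨t', ht'⟩ := hfe γ t
  rw [ht']; exact hγ t'

theorem Bd.ae_eval {x₀ : X} {R : ℝ} {π : Measure (Geo X)} (h : Bd x₀ R π) (t : unitInterval) :
    ∀ᵐ x ∂(π.map (eval t)), x ∈ closedBall x₀ R :=
  (ae_of_map_ae (measurable_eval t) isClosed_closedBall.measurableSet).2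
    (Filter.Eventually.mono h fun γ hγ => hγ t)

theorem Bd.dist {x₀ : X} {R : ℝ} {π : Measure (Geo X)} (h : Bd x₀ R π) :
    ∀ᵐ γ ∂π, dist (eval 0 γ) (eval 1 γ) ≤ 2 * R := by
  refine Filter.Eventually.mono h fun γ hγ => ?_
  have a := mem_closedBall.1 (hγ 0)
  have b := mem_closedBall.1 (hγ 1)
  have := dist_triangle_right (eval 0 γ) (eval 1 γ) x₀
  linarith

theorem isProb_normalize {Z : Type*} [MeasurableSpace Z] (sg : Measure Z) [IsFiniteMeasure sg]
    (h0 : sg ≠ 0) : IsProbabilityMeasure ((sg univ)⁻¹ • sg) := ⟨by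
  rw [Measure.smul_apply, smul_eq_mul, ENNReal.inv_mul_cancel (by simpa using h0)
    (measure_ne_top _ _)]⟩

theorem Setup.cd_of_unique {m : Measure X} {K N : ℝ} (S : Setup m K N)
    {sg : Measure (Geo X)} [IsFiniteMeasure sg] (hsg0 : sg ≠ 0) (hopt : OptC (sg.map ends))
    {x₀ : X} {R : ℝ} (hB : Bd x₀ R sg) 
    (hU : ∀ π, IsOptGeo (((sg univ)⁻¹ • sg).map (eval 0)) (((sg univ)⁻¹ • sg).map (eval 1)) π →
      π = (sg univ)⁻¹ • sg) (t : unitInterval) :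
    CDineq K (N + 1) m ((sg univ)⁻¹ • sg) t := by
  have hp := isProb_normalize sg hsg0
  have hB' : Bd x₀ R ((sg univ)⁻¹ • sg) := hB.ac Measure.smul_absolutelyContinuous
  obtain ⟨π, h1, h2⟩ := S.hCD (((sg univ)⁻¹ • sg).map (eval 0)) (((sg univ)⁻¹ • sg).map (eval 1))
    (Measure.isProbabilityMeasure_map (measurable_eval 0).aemeasurable)
    (Measure.isProbabilityMeasure_map (measurable_eval 1).aemeasurable)
    ⟨closedBall x₀ R, isBounded_closedBall, hB'.ae_eval 0, hB'.ae_eval 1⟩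
  have := h2 t (N + 1) (by linarith)
  rw [hU π h1] at this
  exact this

theorem Setup.unique_ac {m : Measure X} {K N : ℝ} (S : Setup m K N)
    {sg : Measure (Geo X)} [IsFiniteMeasure sg] (hsg0 : sg ≠ 0) (hopt : OptC (sg.map ends))
    {x₀ : X} {R : ℝ} (hB : Bd x₀ R sg) (h0 : sg.map (eval 0) ≪ m) (h1 : sg.map (eval 1) ≪ m) :
    ∀ π, IsOptGeo (((sg univ)⁻¹ • sg).map (eval 0)) (((sg univ)⁻¹ • sg).map (eval 1)) π →
      π = (sg univ)⁻¹ • sg := by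
  intro π hπ
  have hp := isProb_normalize sg hsg0
  have hB' : Bd x₀ R ((sg univ)⁻¹ • sg) := hB.ac Measure.smul_absolutelyContinuous
  have hio : IsOptGeo (((sg univ)⁻¹ • sg).map (eval 0)) (((sg univ)⁻¹ • sg).map (eval 1))
      ((sg univ)⁻¹ • sg) := by
    apply OptC.isOptGeo
    rw [Measure.map_smul]
    exact hopt.smul (ENNReal.inv_ne_top.2 (by simpa using hsg0))
  have p0 := Measure.isProbabilityMeasure_map (μ := (sg univ)⁻¹ • sg) (measurable_eval 0).aemeasurable
  have p1 := Measure.isProbabilityMeasure_map (μ := (sg univ)⁻¹ • sg) (measurable_eval 1).aemeasurable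
  have := (S.hGT _ _ p0 p1 (moment_of_bdd (hB'.ae_eval 0)) (moment_of_bdd (hB'.ae_eval 1))
    (by rw [Measure.map_smul]; exact Measure.smul_absolutelyContinuous.trans h0)
    (by rw [Measure.map_smul]; exact Measure.smul_absolutelyContinuous.trans h1)).1
  exact this.unique hπ hio

theorem Setup.ac_mid {m : Measure X} {K N : ℝ} (S : Setup m K N) [IsLocallyFiniteMeasure m]
    {sg : Measure (Geo X)} [IsFiniteMeasure sg] (h0 : sg.map (eval 0) ≪ m) {t : unitInterval}
    (hI : ∀ sg' : Measure (Geo X), sg' ≤ sg → sg' ≠ 0 → CDineq K (N + 1) m ((sg' univ)⁻¹ • sg') t)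
    (ht : (t : ℝ) < 1) :
    sg.map (eval t) ≪ m := by
  refine Measure.AbsolutelyContinuous.mk fun E hE hE0 => ?_
  rw [Measure.map_apply (measurable_eval t) hE]
  by_contra hne
  set sg' := sg.restrict (eval t ⁻¹' E) with hsg'
  have hle : sg' ≤ sg := Measure.restrict_le_self
  have hsg'0 : sg' ≠ 0 := by
    rw [hsg', Ne, Measure.restrict_eq_zero]; exact hne
  have hp := isProb_normalize sg' hsg'0
  have hN := S.hN
  refine (hI sg' hle hsg'0).not_singular (by linarith) ht ?_ ?_
  · rw [Measure.map_smul]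
    exact Measure.smul_absolutelyContinuous.trans
      ((Measure.absolutelyContinuous_of_le (Measure.map_mono hle (measurable_eval 0))).trans h0)
  · refine ⟨Eᶜ, hE.compl, ?_, by simpa using hE0⟩
    rw [Measure.map_smul, Measure.smul_apply, Measure.map_apply (measurable_eval t) hE.compl,
      hsg', Measure.restrict_apply ((measurable_eval t) hE.compl)]
    simp

theorem Setup.ac_mid' {m : Measure X} {K N : ℝ} (S : Setup m K N) [IsLocallyFiniteMeasure m]
    {sg : Measure (Geo X)} [IsFiniteMeasure sg] (hopt : OptC (sg.map ends))
    {x₀ : X} {R : ℝ} (hB : Bd x₀ R sg) (h0 : sg.map (eval 0) ≪ m) (h1 : sg.map (eval 1) ≪ m)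
    {t : unitInterval} (ht : (t : ℝ) < 1) : sg.map (eval t) ≪ m := by
  refine S.ac_mid h0 (fun sg' hle hne => ?_) ht
  have hf : IsFiniteMeasure sg' := isFiniteMeasure_of_le sg hle
  have hac := Measure.absolutelyContinuous_of_le hle
  have ho := hopt.mono (Measure.map_mono hle measurable_ends)
  refine S.cd_of_unique hne ho (hB.ac hac) (S.unique_ac hne ho (hB.ac hac) ?_ ?_) t
  · exact (hac.map (measurable_eval 0)).trans h0
  · exact (hac.map (measurable_eval 1)).trans h1

theorem Setup.vol {m : Measure X} {K N : ℝ} (S : Setup m K N) [IsLocallyFiniteMeasure m] (R : ℝ) :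
    ∃ η : ℝ, 0 < η ∧ ∀ (x₀ : X) (sg : Measure (Geo X)) (D : Set X) (t : unitInterval) (E : Set X),
      IsCompact D → m D ≠ 0 → sg.map (eval 0) = m.restrict D → sg.map (eval 1) ≪ m →
      OptC (sg.map ends) → Bd x₀ R sg → (t : ℝ) ≤ η → MeasurableSet E →
      (∀ᵐ γ ∂sg, eval t γ ∈ E) → 3 * m D ≤ 4 * m E := by
  have hN := S.hN
  set C := Real.cosh ((2 * R) * Real.sqrt (|K| / (N + 1))) with hC
  have hlim : Filter.Tendsto (fun t : ℝ => ENNReal.ofReal (1 - t * C) ^ (N + 1)) (nhds 0)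
      (nhds (ENNReal.ofReal (1 - 0 * C) ^ (N + 1))) := by
    refine Filter.Tendsto.ennrpow_const _ (ENNReal.tendsto_ofReal ?_)
    exact Continuous.tendsto (f := fun t : ℝ => 1 - t * C) (by fun_prop) 0
  have h34 : (3 / 4 : ℝ≥0∞) < 1 := by
    rw [ENNReal.div_lt_iff] <;> norm_num
  have hev := hlim.eventually (lt_mem_nhds (a := (3 / 4 : ℝ≥0∞)) (by simpa using h34))
  obtain ⟨η, hη, hball⟩ := Metric.eventually_nhds_iff.1 hev
  refine ⟨η / 2, half_pos hη, fun x₀ sg D t E hD hD0 e0 h1 hopt hB ht hE hEsg => ?_⟩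
  have hDt : m D ≠ ⊤ := hD.measure_lt_top.ne
  have hsgu : sg univ = m D := by
    rw [← preimage_univ (f := eval 0), ← Measure.map_apply (measurable_eval 0) .univ, e0]; simp
  have hfin : IsFiniteMeasure sg := ⟨by rw [hsgu]; exact hDt.lt_top⟩
  have hsg0 : sg ≠ 0 := by
    intro h; rw [h] at hsgu; exact hD0 (by simpa using hsgu.symm)
  have h0 : sg.map (eval 0) ≪ m := by
    rw [e0]; exact Measure.restrict_le_self.absolutelyContinuous
  have hI := S.cd_of_unique hsg0 hopt hB (S.unique_ac hsg0 hopt hB h0 h1) t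
  have hp := isProb_normalize sg hsg0
  have hB' : Bd x₀ R ((sg univ)⁻¹ • sg) := hB.ac Measure.smul_absolutelyContinuous
  have := hI.lower (by linarith) hD.isClosed.measurableSet hD0 hDt
    (by rw [Measure.map_smul, e0, hsgu]) hB'.dist
  have hg := hball (y := (t : ℝ)) (by
    rw [Real.dist_eq, sub_zero, abs_of_nonneg t.2.1]; linarith)
  have hle : m {x | (((sg univ)⁻¹ • sg).map (eval t)).rnDeriv m x ≠ 0} ≤ m E := by
    apply measure_mono_ae
    have hz : ∫⁻ x in Eᶜ, (((sg univ)⁻¹ • sg).map (eval t)).rnDeriv m x ∂m = 0 := by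
      refine le_antisymm ((Measure.setLIntegral_rnDeriv_le _).trans ?_) zero_le
      rw [Measure.map_smul, Measure.smul_apply, Measure.map_apply (measurable_eval t) hE.compl]
      have : sg (eval t ⁻¹' Eᶜ) = 0 := hEsg
      rw [this]; simp
    rw [lintegral_eq_zero_iff (Measure.measurable_rnDeriv _ _), Filter.EventuallyEq,
      ae_restrict_iff' hE.compl] at hz
    filter_upwards [hz] with x hx hx'
    by_contra hxE
    exact hx' (hx hxE)
  have h5 : 3 / 4 * m D ≤ m E := by
    refine le_trans ?_ (this.trans hle)
    gcongr
  calc 3 * m D = 4 * (3 / 4 * m D) := by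
        rw [← mul_assoc, ENNReal.mul_div_cancel (by norm_num) (by norm_num)]
    _ ≤ 4 * m E := by gcongr

theorem common {Z : Type*} [MeasurableSpace Z] {m : Measure X} [IsLocallyFiniteMeasure m]
    {sg₁ sg₂ : Measure Z} [IsFiniteMeasure sg₁] [IsFiniteMeasure sg₂] {e : Z → X} (he : Measurable e)
    (h1 : sg₁.map e ≪ m) (h2 : sg₂.map e ≪ m) (hns : ¬ (sg₁.map e) ⟂ₘ (sg₂.map e)) :
    ∃ D : Set X, IsCompact D ∧ m D ≠ 0 ∧ ∃ C : ℝ≥0∞, C ≠ ⊤ ∧ ∃ sg₁' sg₂' : Measure Z,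
      sg₁' ≤ C • sg₁ ∧ sg₂' ≤ C • sg₂ ∧ sg₁'.map e = m.restrict D ∧ sg₂'.map e = m.restrict D := by
  set ρ₁ := (sg₁.map e).rnDeriv m with hρ₁
  set ρ₂ := (sg₂.map e).rnDeriv m with hρ₂
  have m1 : Measurable ρ₁ := Measure.measurable_rnDeriv _ _
  have m2 : Measurable ρ₂ := Measure.measurable_rnDeriv _ _
  have hI : ∫⁻ x in univ, min (ρ₁ x) (ρ₂ x) ∂m ≠ 0 := by
    intro hz
    apply hns
    rw [lintegral_eq_zero_iff (m1.min m2), Measure.restrict_univ] at hz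
    have hA : MeasurableSet {x | ρ₁ x = 0} := measurableSet_eq_fun m1 measurable_const
    refine ⟨{x | ρ₁ x = 0}, hA, ?_, ?_⟩
    · rw [← Measure.setLIntegral_rnDeriv h1, ← hρ₁, setLIntegral_congr_fun hA (g := fun _ => 0)
        (fun x hx => hx)]
      simp
    · rw [← Measure.setLIntegral_rnDeriv h2, ← hρ₂, lintegral_eq_zero_iff m2, Filter.EventuallyEq,
        ae_restrict_iff' hA.compl]
      filter_upwards [hz] with x hx hx'
      rcases min_eq_iff.1 hx with h | h
      · exact absurd h.1 hx'
      · exact h.1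
  obtain ⟨c, hc0, hct, D, -, hD, hD0, hlow⟩ := exists_compact_lower (m1.min m2) .univ hI
  obtain ⟨sg₁', a1, b1⟩ := reweight he h1 hD.isClosed.measurableSet
    (fun x hx => (hlow x hx).trans (min_le_left _ _)) hc0
  obtain ⟨sg₂', a2, b2⟩ := reweight he h2 hD.isClosed.measurableSet
    (fun x hx => (hlow x hx).trans (min_le_right _ _)) hc0
  exact ⟨D, hD, hD0, c⁻¹, ENNReal.inv_ne_top.2 hc0, sg₁', sg₂', a1, a2, b1, b2⟩
end

section
variable {Y : Type*} [MetricSpace Y]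
/-- piece from time s to 1 -/
def fwd (s : unitInterval) (γ : Geo Y) : Geo Y := rev (restr (unitInterval.symm s) (rev γ))
/-- piece from time b to 0 -/
def bwd (b : unitInterval) (γ : Geo Y) : Geo Y := rev (restr b γ)

theorem eval_fwd (s t : unitInterval) (γ : Geo Y) :
    eval t (fwd s γ) = eval (unitInterval.symm (unitInterval.symm s * unitInterval.symm t)) γ := by
  simp [fwd]
theorem eval_bwd (b t : unitInterval) (γ : Geo Y) :
    eval t (bwd b γ) = eval (b * unitInterval.symm t) γ := by
  simp [bwd]
theorem fwd_continuous (s : unitInterval) : Continuous (fwd s : Geo Y → Geo Y) :=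
  rev_continuous.comp ((restr_continuous _).comp rev_continuous)
theorem bwd_continuous (s : unitInterval) : Continuous (bwd s : Geo Y → Geo Y) :=
  rev_continuous.comp (restr_continuous _)
end

section
variable [BorelSpace X] [ProperSpace X]

theorem measurable_fwd (s : unitInterval) : Measurable (fwd s : Geo X → Geo X) :=
  (fwd_continuous s).measurable
theorem measurable_bwd (s : unitInterval) : Measurable (bwd s : Geo X → Geo X) :=
  (bwd_continuous s).measurable

theorem OptC.fwd [Nonempty X] {π : Measure (Geo X)} [IsFiniteMeasure π] (h : OptC (π.map ends))
    {s : unitInterval} (h0 : (0:ℝ) < s) (h1 : (s:ℝ) < 1) : OptC ((π.map (_root_.fwd s)).map ends) := by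
  have h2 := (h.rev.restr (s := unitInterval.symm s)
    (by
      change (0:ℝ) < _; rw [unitInterval.coe_symm_eq]; linarith)
    (by
      change _ < (1:ℝ); rw [unitInterval.coe_symm_eq]; linarith)).rev
  rw [Measure.map_map measurable_rev (measurable_restr _),
    Measure.map_map (measurable_rev.comp (measurable_restr _)) measurable_rev] at h2
  exact h2

theorem OptC.bwd [Nonempty X] {π : Measure (Geo X)} [IsFiniteMeasure π] (h : OptC (π.map ends))
    {s : unitInterval} (h0 : (0:ℝ) < s) (h1 : (s:ℝ) < 1) : OptC ((π.map (_root_.bwd s)).map ends) := by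
  have h2 := (h.restr (s := s) h0 h1).rev
  rw [Measure.map_map measurable_rev (measurable_restr _)] at h2
  exact h2

def VolP (m : Measure X) (R η : ℝ) : Prop :=
  ∀ (x₀ : X) (sg : Measure (Geo X)) (D : Set X) (t : unitInterval) (E : Set X),
      IsCompact D → m D ≠ 0 → sg.map (eval 0) = m.restrict D → sg.map (eval 1) ≪ m →
      OptC (sg.map ends) → Bd x₀ R sg → (t : ℝ) ≤ η → MeasurableSet E →
      (∀ᵐ γ ∂sg, eval t γ ∈ E) → 3 * m D ≤ 4 * m E

theorem Setup.step [Nonempty X] {m : Measure X} {K N : ℝ} (S : Setup m K N) [IsLocallyFiniteMeasure m]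
    {R η : ℝ} (hV : VolP m R η) {x₀ : X} {sg1 sg2 : Measure (Geo X)} [IsFiniteMeasure sg1]
    [IsFiniteMeasure sg2] {D : Set X} (hD : IsCompact D) (hD0 : m D ≠ 0) {s b : unitInterval}
    (e1 : sg1.map (eval s) = m.restrict D) (e2 : sg2.map (eval s) = m.restrict D)
    (hopt : OptC ((sg1 + sg2).map ends)) (hB : Bd x₀ R (sg1 + sg2))
    (h0 : (sg1 + sg2).map (eval 0) ≪ m) (h1 : (sg1 + sg2).map (eval 1) ≪ m)
    (hs0 : (0:ℝ) < s) (hsb : (s:ℝ) < b) (hb1 : (b:ℝ) < 1)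
    (hη1 : ((b:ℝ) - s) / (1 - s) ≤ η) (hη2 : ((b:ℝ) - s) / b ≤ η) :
    ¬ (sg1.map (eval b)) ⟂ₘ (sg2.map (eval b)) := by
  rintro ⟨A, hA, hA1, hA2⟩
  have hDt : m D ≠ ⊤ := hD.measure_lt_top.ne
  have le1 : sg1 ≤ sg1 + sg2 := Measure.le_add_right le_rfl
  have le2 : sg2 ≤ sg1 + sg2 := Measure.le_add_left le_rfl
  set ω := sg1 + sg2 with hω
  set ρ := (ω.map (eval b)).rnDeriv m with hρ
  have mρ : Measurable ρ := Measure.measurable_rnDeriv _ _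
  have hbac : ω.map (eval b) ≪ m := S.ac_mid' hopt hB h0 h1 hb1
  set E := {x | ρ x ≠ 0} with hE
  have mE : MeasurableSet E := (measurableSet_eq_fun mρ measurable_const).compl
  have hωE : ∀ᵐ γ ∂ω, eval b γ ∈ E := by
    refine (ae_of_map_ae (measurable_eval b) mE).1 ?_
    change (ω.map (eval b)) Eᶜ = 0
    rw [← Measure.setLIntegral_rnDeriv hbac, setLIntegral_congr_fun (g := fun _ => 0) mE.compl]
    · simp
    · intro x hx
      simpa [hE] using hx
  rw [Measure.map_apply (measurable_eval b) hA] at hA1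
  rw [Measure.map_apply (measurable_eval b) hA.compl] at hA2
  have a1 : ∀ᵐ γ ∂sg1, eval b γ ∈ E ∩ Aᶜ := by
    have : ∀ᵐ γ ∂sg1, eval b γ ∈ Aᶜ := by
      rw [ae_iff]; simp only [mem_compl_iff, not_not]; exact hA1
    filter_upwards [le1.absolutelyContinuous.ae_le hωE, this] with γ h h' using ⟨h, h'⟩
  have a2 : ∀ᵐ γ ∂sg2, eval b γ ∈ E ∩ A := by
    have : ∀ᵐ γ ∂sg2, eval b γ ∈ A := by
      rw [ae_iff]; exact hA2
    filter_upwards [le2.absolutelyContinuous.ae_le hωE, this] with γ h h' using ⟨h, h'⟩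
  have hs1 : (s:ℝ) < 1 := hsb.trans hb1
  have hb0 : (0:ℝ) < b := hs0.trans hsb
  -- forward times
  have hp : 0 < 1 - (s:ℝ) := by linarith
  let t1 : unitInterval := ⟨((b:ℝ) - s) / (1 - s), div_nonneg (by linarith) hp.le,
    (div_le_one hp).2 (by linarith)⟩
  have ht1 : unitInterval.symm (unitInterval.symm s * unitInterval.symm t1) = b := by
    apply Subtype.ext
    simp only [unitInterval.coe_symm_eq, Set.Icc.coe_mul, t1]
    field_simp
    ring
  have key : ∀ τ : Measure (Geo X), τ ≤ ω → τ.map (eval s) = m.restrict D → ∀ F, MeasurableSet F →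
      (∀ᵐ γ ∂τ, eval b γ ∈ F) → 3 * m D ≤ 4 * m F := by
    intro τ hτ he F hF hae
    have hac := Measure.absolutelyContinuous_of_le hτ
    have : IsFiniteMeasure τ := isFiniteMeasure_of_le ω hτ
    have hmp : ∀ t, (τ.map (fwd s)).map (eval t) = τ.map (eval (unitInterval.symm (unitInterval.symm s * unitInterval.symm t))) := by
      intro t
      rw [Measure.map_map (measurable_eval _) (measurable_fwd _)]
      congr 1
    refine hV x₀ (τ.map (fwd s)) D t1 F hD hD0 ?_ ?_ ?_ ?_ hη1 hF ?_
    · rw [hmp]; simpa using he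
    · rw [hmp]; simpa using (hac.map (measurable_eval 1)).trans h1
    · exact (hopt.mono (Measure.map_mono hτ measurable_ends)).fwd hs0 hs1
    · exact (hB.ac hac).map (measurable_fwd _) fun γ t => ⟨_, eval_fwd _ _ _⟩
    · refine (ae_of_map_ae (measurable_fwd s) (B := eval t1 ⁻¹' F) (measurable_eval _ hF)).2 ?_
      filter_upwards [hae] with γ hγ
      rw [mem_preimage, eval_fwd, ht1]; exact hγ
  have k1 := key sg1 le1 e1 _ (mE.inter hA.compl) a1
  have k2 := key sg2 le2 e2 _ (mE.inter hA) a2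
  have k3 : 6 * m D ≤ 4 * m E := by
    have : m E = m (E ∩ A) + m (E ∩ Aᶜ) := by
      rw [← diff_eq, measure_inter_add_diff _ hA]
    calc 6 * m D = 3 * m D + 3 * m D := by ring
      _ ≤ 4 * m (E ∩ A) + 4 * m (E ∩ Aᶜ) := add_le_add k2 k1
      _ = 4 * m E := by rw [this]; ring
  have k4 : 4 * m D / 3 < m E := by
    rw [ENNReal.div_lt_iff (by norm_num) (by norm_num)]
    by_contra hcon
    push Not at hcon
    have : 18 * m D ≤ 16 * m D := by
      calc 18 * m D = 3 * (6 * m D) := by ring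
        _ ≤ 3 * (4 * m E) := by gcongr
        _ = 4 * (m E * 3) := by ring
        _ ≤ 4 * (4 * m D) := by gcongr
        _ = 16 * m D := by ring
    rw [ENNReal.mul_le_mul_iff_left hD0 hDt] at this
    norm_num at this
  obtain ⟨c, hc0, hct, hclt⟩ : ∃ c : ℝ≥0∞, c ≠ 0 ∧ c ≠ ⊤ ∧ 4 * m D / 3 < m {x | c ≤ ρ x} := by
    have hu : E = ⋃ n : ℕ, {x | ((n:ℝ≥0∞) + 1)⁻¹ ≤ ρ x} := by
      ext x
      simp only [hE, mem_setOf_eq, mem_iUnion]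
      constructor
      · intro hx
        obtain ⟨n, hn⟩ := ENNReal.exists_inv_nat_lt hx
        exact ⟨n, (ENNReal.inv_le_inv.2 (by simp)).trans hn.le⟩
      · rintro ⟨n, hn⟩ h0
        rw [h0] at hn
        simp at hn
    have hmono : Monotone fun n : ℕ => {x | ((n:ℝ≥0∞) + 1)⁻¹ ≤ ρ x} := by
      intro a b hab x hx
      refine le_trans (ENNReal.inv_le_inv.2 ?_) hx
      gcongr
    rw [hu, hmono.measure_iUnion] at k4
    obtain ⟨n, hn⟩ := lt_iSup_iff.1 k4
    exact ⟨_, by simp, by simp, hn⟩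
  obtain ⟨E', hE'sub, hE', hE'lt⟩ := (measurableSet_le measurable_const mρ :
    MeasurableSet {x | c ≤ ρ x}).exists_lt_isCompact hclt
  obtain ⟨ω', hω'le, hω'e⟩ := reweight (measurable_eval b) hbac hE'.isClosed.measurableSet
    (fun x hx => hE'sub hx) hc0
  have hE'0 : m E' ≠ 0 := by
    intro h; rw [h] at hE'lt; simp at hE'lt
  have hcc : c⁻¹ ≠ ⊤ := ENNReal.inv_ne_top.2 hc0
  have hac : ω' ≪ ω := (Measure.absolutelyContinuous_of_le hω'le).trans Measure.smul_absolutelyContinuous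
  have hoo : OptC (ω'.map ends) := by
    refine OptC.mono (hopt.smul hcc) ?_
    rw [← Measure.map_smul]
    exact Measure.map_mono hω'le measurable_ends
  have hff : IsFiniteMeasure ω' := by
    have := Measure.smul_finite ω hcc
    exact isFiniteMeasure_of_le _ hω'le
  let t2 : unitInterval := ⟨((b:ℝ) - s) / b, div_nonneg (by linarith) hb0.le,
    (div_le_one hb0).2 (by linarith)⟩
  have ht2 : b * unitInterval.symm t2 = s := by
    apply Subtype.ext
    simp only [unitInterval.coe_symm_eq, Set.Icc.coe_mul, t2]
    field_simp
    ring
  have hmp : ∀ t, (ω'.map (bwd b)).map (eval t) = ω'.map (eval (b * unitInterval.symm t)) := by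
    intro t
    rw [Measure.map_map (measurable_eval _) (measurable_bwd _)]
    congr 1
  have hDs : ∀ᵐ γ ∂ω, eval s γ ∈ D := by
    refine (ae_of_map_ae (measurable_eval s) hD.isClosed.measurableSet).1 ?_
    rw [hω, Measure.map_add _ _ (measurable_eval s), e1, e2, ae_add_measure_iff]
    exact ⟨ae_restrict_mem hD.isClosed.measurableSet, ae_restrict_mem hD.isClosed.measurableSet⟩
  have k5 : 3 * m E' ≤ 4 * m D := by
    refine hV x₀ (ω'.map (bwd b)) E' t2 D hE' hE'0 ?_ ?_ ?_ ?_ hη2 hD.isClosed.measurableSet ?_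
    · rw [hmp]; simpa using hω'e
    · rw [hmp]; simpa using (hac.map (measurable_eval 0)).trans h0
    · exact hoo.bwd hb0 hb1
    · exact (hB.ac hac).map (measurable_bwd _) fun γ t => ⟨_, eval_bwd _ _ _⟩
    · refine (ae_of_map_ae (measurable_bwd b) (B := eval t2 ⁻¹' D) (measurable_eval _ hD.isClosed.measurableSet)).2 ?_
      filter_upwards [hac.ae_le hDs] with γ hγ
      rw [mem_preimage, eval_bwd, ht2]; exact hγ
  rw [ENNReal.div_lt_iff (by norm_num) (by norm_num)] at hE'lt
  exact absurd (hE'lt.trans_le (by rw [mul_comm]; exact k5)) (lt_irrefl _)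
end

section
variable [BorelSpace X] [ProperSpace X]

def Good (m : Measure X) (sg1 sg2 : Measure (Geo X)) (s : unitInterval) : Prop :=
  ∃ D : Set X, IsCompact D ∧ m D ≠ 0 ∧ ∃ C : ℝ≥0∞, C ≠ ⊤ ∧ ∃ sg1' sg2' : Measure (Geo X),
      sg1' ≤ C • sg1 ∧ sg2' ≤ C • sg2 ∧ sg1'.map (eval s) = m.restrict D ∧ sg2'.map (eval s) = m.restrict D

theorem Setup.good_step [Nonempty X] {m : Measure X} {K N : ℝ} (S : Setup m K N) [IsLocallyFiniteMeasure m]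
    {R η : ℝ} (hV : VolP m R η) {x₀ : X} {sg1 sg2 : Measure (Geo X)} [IsFiniteMeasure sg1]
    [IsFiniteMeasure sg2] {s b : unitInterval}
    (hopt : OptC ((sg1 + sg2).map ends)) (hB : Bd x₀ R (sg1 + sg2))
    (h0 : (sg1 + sg2).map (eval 0) ≪ m) (h1 : (sg1 + sg2).map (eval 1) ≪ m)
    (hs0 : (0:ℝ) < s) (hsb : (s:ℝ) < b) (hb1 : (b:ℝ) < 1)
    (hη1 : ((b:ℝ) - s) / (1 - s) ≤ η) (hη2 : ((b:ℝ) - s) / b ≤ η)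
    (hg : Good m sg1 sg2 s) : Good m sg1 sg2 b := by
  obtain ⟨D, hD, hD0, C, hC, s1, s2, l1, l2, e1, e2⟩ := hg
  have hle : s1 + s2 ≤ C • (sg1 + sg2) := by
    rw [smul_add]; exact add_le_add l1 l2
  have hac : s1 + s2 ≪ sg1 + sg2 :=
    (Measure.absolutelyContinuous_of_le hle).trans Measure.smul_absolutelyContinuous
  have f1 : IsFiniteMeasure s1 := by
    have := Measure.smul_finite sg1 hC
    exact isFiniteMeasure_of_le _ l1
  have f2 : IsFiniteMeasure s2 := by
    have := Measure.smul_finite sg2 hC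
    exact isFiniteMeasure_of_le _ l2
  have ho : OptC ((s1 + s2).map ends) := by
    refine OptC.mono (hopt.smul hC) ?_
    rw [← Measure.map_smul]
    exact Measure.map_mono hle measurable_ends
  have hB' := hB.ac hac
  have h0' := (hac.map (measurable_eval 0)).trans h0
  have h1' := (hac.map (measurable_eval 1)).trans h1
  have hns := S.step hV hD hD0 e1 e2 ho hB' h0' h1' hs0 hsb hb1 hη1 hη2
  have hbac := S.ac_mid' ho hB' h0' h1' hb1
  obtain ⟨D', hD', hD'0, C', hC', s1', s2', l1', l2', e1', e2'⟩ := common (measurable_eval b)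
    (((Measure.absolutelyContinuous_of_le (Measure.le_add_right le_rfl)).map (measurable_eval b)).trans hbac)
    (((Measure.absolutelyContinuous_of_le (Measure.le_add_left le_rfl)).map (measurable_eval b)).trans hbac)
    hns
  refine ⟨D', hD', hD'0, C' * C, ENNReal.mul_ne_top hC' hC, s1', s2', ?_, ?_, e1', e2'⟩
  · rw [mul_smul]; refine l1'.trans ?_; gcongr
  · rw [mul_smul]; refine l2'.trans ?_; gcongr

theorem Setup.no_split [Nonempty X] {m : Measure X} {K N : ℝ} (S : Setup m K N) [IsLocallyFiniteMeasure m]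
    {R : ℝ} {x₀ : X} {sg1 sg2 : Measure (Geo X)} [IsFiniteMeasure sg1]
    [IsFiniteMeasure sg2] {D : Set X} (hD : IsCompact D) (hD0 : m D ≠ 0)
    (e1 : sg1.map (eval 0) = m.restrict D) (e2 : sg2.map (eval 0) = m.restrict D)
    (hopt : OptC ((sg1 + sg2).map ends)) (hB : Bd x₀ R (sg1 + sg2))
    (h1 : (sg1 + sg2).map (eval 1) ≪ m) {u : unitInterval} (hu0 : (0:ℝ) < u) (hu1 : (u:ℝ) < 1) :
    ¬ (sg1.map (eval u)) ⟂ₘ (sg2.map (eval u)) := by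
  intro hsing
  have h0 : (sg1 + sg2).map (eval 0) ≪ m := by
    rw [Measure.map_add _ _ (measurable_eval 0), e1, e2]
    exact Measure.AbsolutelyContinuous.add_left Measure.restrict_le_self.absolutelyContinuous
      Measure.restrict_le_self.absolutelyContinuous
  have hDt : m D ≠ ⊤ := hD.measure_lt_top.ne
  have le1 : sg1 ≤ sg1 + sg2 := Measure.le_add_right le_rfl
  have le2 : sg2 ≤ sg1 + sg2 := Measure.le_add_left le_rfl
  obtain ⟨η, hη, hV⟩ := S.vol R
  replace hV : VolP m R η := hV
  -- thickening
  obtain ⟨ε, hε, hεD⟩ : ∃ ε : ℝ, 0 < ε ∧ m (cthickening ε D) < 3 / 2 * m D := by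
    have ht := tendsto_measure_cthickening_of_isCompact (μ := m) hD
    have hlt : m D < 3 / 2 * m D := by
      conv_lhs => rw [← one_mul (m D)]
      refine ENNReal.mul_lt_mul_left hD0 hDt ?_
      rw [ENNReal.lt_div_iff_mul_lt] <;> norm_num
    have hev := ht.eventually (gt_mem_nhds hlt)
    obtain ⟨ε, hε, hb⟩ := Metric.eventually_nhds_iff.1 hev
    refine ⟨ε / 2, half_pos hε, hb ?_⟩
    rw [Real.dist_eq, sub_zero, abs_of_pos (half_pos hε)]; linarith
  set t0r : ℝ := min η (min (u / 2) (ε / (2 * |R| + 1))) with ht0r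
  have hR : 0 < 2 * |R| + 1 := by positivity
  have ht0pos : 0 < t0r := lt_min hη (lt_min (by linarith) (by positivity))
  have ht0η : t0r ≤ η := min_le_left _ _
  have ht0u : t0r ≤ u / 2 := (min_le_right _ _).trans (min_le_left _ _)
  have ht0ε : t0r * (2 * |R| + 1) ≤ ε := by
    rw [← le_div_iff₀ hR]; exact (min_le_right _ _).trans (min_le_right _ _)
  let t0 : unitInterval := ⟨t0r, ht0pos.le, by linarith⟩
  have hg0 : Good m sg1 sg2 t0 := by
    have hac0 := S.ac_mid' hopt hB h0 h1 (t := t0) (by change t0r < 1; linarith)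
    have hth : ∀ᵐ γ ∂(sg1 + sg2), eval t0 γ ∈ cthickening ε D := by
      have hd : ∀ᵐ γ ∂(sg1 + sg2), eval 0 γ ∈ D := by
        refine (ae_of_map_ae (measurable_eval 0) hD.isClosed.measurableSet).1 ?_
        rw [Measure.map_add _ _ (measurable_eval 0), e1, e2, ae_add_measure_iff]
        exact ⟨ae_restrict_mem hD.isClosed.measurableSet, ae_restrict_mem hD.isClosed.measurableSet⟩
      filter_upwards [hd, hB.dist] with γ h h'
      refine mem_cthickening_of_dist_le _ _ _ _ h ?_
      rw [geo_dist γ t0 0]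
      have : |((t0:unitInterval):ℝ) - ((0:unitInterval):ℝ)| = t0r := by
        simp [t0, abs_of_pos ht0pos]
      rw [this]
      refine le_trans ?_ ht0ε
      gcongr
      have := le_abs_self R
      linarith
    have key : ∀ τ : Measure (Geo X), τ ≤ sg1 + sg2 → τ.map (eval 0) = m.restrict D → ∀ F, MeasurableSet F →
      (∀ᵐ γ ∂τ, eval t0 γ ∈ F) → 3 * m D ≤ 4 * m (cthickening ε D ∩ F) := by
      intro τ hτ he F hF hae
      have hac := Measure.absolutelyContinuous_of_le hτ
      refine hV x₀ τ D t0 _ hD hD0 he ((hac.map (measurable_eval 1)).trans h1)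
        (hopt.mono (Measure.map_mono hτ measurable_ends)) (hB.ac hac) ht0η
        (isClosed_cthickening.measurableSet.inter hF) ?_
      filter_upwards [hae, hac.ae_le hth] with γ h h' using ⟨h', h⟩
    have hns : ¬ (sg1.map (eval t0)) ⟂ₘ (sg2.map (eval t0)) := by
      rintro ⟨A, hA, hA1, hA2⟩
      rw [Measure.map_apply (measurable_eval _) hA] at hA1
      rw [Measure.map_apply (measurable_eval _) hA.compl] at hA2
      have k1 := key sg1 le1 e1 _ hA.compl (by
        rw [ae_iff]; simp only [mem_compl_iff, not_not]; exact hA1)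
      have k2 := key sg2 le2 e2 _ hA (by rw [ae_iff]; exact hA2)
      have : m (cthickening ε D) = m (cthickening ε D ∩ A) + m (cthickening ε D ∩ Aᶜ) := by
        rw [← diff_eq, measure_inter_add_diff _ hA]
      have h6 : 6 * m D ≤ 4 * m (cthickening ε D) := by
        calc 6 * m D = 3 * m D + 3 * m D := by ring
          _ ≤ _ := add_le_add k2 k1
          _ = _ := by rw [this]; ring
      have h7 : 4 * m (cthickening ε D) < 4 * (3 / 2 * m D) :=
        ENNReal.mul_lt_mul_right (by norm_num) (by norm_num) hεD
      have h8 : 4 * (3 / 2 * m D) = 6 * m D := by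
        rw [← mul_assoc]; congr 1
        rw [← mul_div_assoc]
        exact ((ENNReal.eq_div_iff (by norm_num) (by norm_num)).2 (by norm_num)).symm
      rw [h8] at h7
      exact absurd (h6.trans_lt h7) (lt_irrefl _)
    exact common (measurable_eval t0)
      (((Measure.absolutelyContinuous_of_le le1).map (measurable_eval _)).trans hac0)
      (((Measure.absolutelyContinuous_of_le le2).map (measurable_eval _)).trans hac0) hns
  set δ : ℝ := min (η * (1 - u)) (η * t0r) with hδ
  have hδ0 : 0 < δ := lt_min (mul_pos hη (by linarith)) (mul_pos hη ht0pos)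
  have hind : ∀ k : ℕ, ∀ b : unitInterval, (b:ℝ) = min (t0r + k * δ) u → Good m sg1 sg2 b := by
    intro k
    induction k with
    | zero =>
      intro b hb
      have : b = t0 := by
        apply Subtype.ext
        rw [hb]; simp [t0]; linarith
      rw [this]; exact hg0
    | succ k ih =>
      intro b hb
      have hkδ : 0 ≤ (k:ℝ) * δ := by positivity
      by_cases hc : (u:ℝ) ≤ t0r + k * δ
      · refine ih b ?_
        rw [hb, min_eq_right hc, min_eq_right]
        push_cast; linarith
      · push Not at hc
        let s : unitInterval := ⟨t0r + k * δ, by positivity, by linarith⟩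
        have hs : (s:ℝ) = t0r + k * δ := rfl
        have hgs := ih s (by rw [hs, min_eq_left hc.le])
        have hbu : (b:ℝ) ≤ u := by rw [hb]; exact min_le_right _ _
        have hbs : (b:ℝ) ≤ s + δ := by
          rw [hb, hs]; refine (min_le_left _ _).trans ?_; push_cast; linarith
        have hsb : (s:ℝ) < b := by
          rw [hb, hs]; refine lt_min ?_ hc; push_cast; linarith
        have hd1 : δ ≤ η * (1 - u) := min_le_left _ _
        have hd2 : δ ≤ η * t0r := min_le_right _ _
        have hsp : 0 < (s:ℝ) := by rw [hs]; linarith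
        refine S.good_step hV hopt hB h0 h1 hsp hsb (by linarith) ?_ ?_ hgs
        · rw [div_le_iff₀ (by linarith)]
          calc (b:ℝ) - s ≤ η * (1 - u) := by linarith
            _ ≤ η * (1 - s) := by gcongr
        · rw [div_le_iff₀ (by linarith)]
          calc (b:ℝ) - s ≤ η * t0r := by linarith
            _ ≤ η * b := by gcongr; linarith
  obtain ⟨k, hk⟩ := Archimedean.arch (u:ℝ) hδ0
  have hgu := hind k u (by
    rw [min_eq_right]; rw [nsmul_eq_mul] at hk; linarith)
  obtain ⟨D', hD', hD'0, C, hC, s1, s2, l1, l2, f1, f2⟩ := hgu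
  have g1 : s1.map (eval u) ≪ sg1.map (eval u) :=
    ((Measure.absolutelyContinuous_of_le l1).trans Measure.smul_absolutelyContinuous).map (measurable_eval u)
  have g2 : s2.map (eval u) ≪ sg2.map (eval u) :=
    ((Measure.absolutelyContinuous_of_le l2).trans Measure.smul_absolutelyContinuous).map (measurable_eval u)
  have := hsing.mono_ac g1 g2
  rw [f1, f2, Measure.MutuallySingular.self_iff, Measure.restrict_eq_zero] at this
  exact hD'0 this
end

section
variable [BorelSpace X] [ProperSpace X]

theorem geo_bd {x₀ : X} {R : ℝ} {γ : Geo X} (h0 : eval 0 γ ∈ closedBall x₀ R)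
    (h1 : eval 1 γ ∈ closedBall x₀ R) (t : unitInterval) : eval t γ ∈ closedBall x₀ (3 * R) := by
  rw [mem_closedBall] at *
  have h2 := geo_dist γ t 0
  have h3 := dist_triangle_right (eval 0 γ) (eval 1 γ) x₀
  have h4 := dist_triangle (eval t γ) (eval 0 γ) x₀
  have h5 : |(t:ℝ) - ((0:unitInterval):ℝ)| ≤ 1 := by
    rw [Set.Icc.coe_zero, sub_zero, abs_of_nonneg t.2.1]; exact t.2.2
  have h6 : dist (eval t γ) (eval 0 γ) ≤ 1 * dist (eval 0 γ) (eval 1 γ) := by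
    rw [h2]; gcongr
  linarith

theorem restrict_map_sub {Z : Type*} [MeasurableSpace Z] {m : Measure X} {κ : Measure Z} {e : Z → X}
    (he : Measurable e) {D D' : Set X} (hD' : MeasurableSet D') (hs : D' ⊆ D)
    (h : κ.map e = m.restrict D) : (κ.restrict (e ⁻¹' D')).map e = m.restrict D' := by
  rw [← Measure.restrict_map he hD', h, Measure.restrict_restrict hD', inter_eq_left.2 hs]

theorem finite_of_map {Z : Type*} [MeasurableSpace Z] {m : Measure X} [IsLocallyFiniteMeasure m]
    {κ : Measure Z} {e : Z → X}
    (he : Measurable e) {D : Set X} (hD : IsCompact D)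
    (h : κ.map e = m.restrict D) : IsFiniteMeasure κ := ⟨by
  rw [← preimage_univ (f := e), ← Measure.map_apply he .univ, h]
  simpa using hD.measure_lt_top⟩

theorem Setup.sep [Nonempty X] {m : Measure X} {K N : ℝ} (S : Setup m K N) [IsLocallyFiniteMeasure m]
    {κ : Measure (X × X)} (hκ : OptC κ) (hκm : κ.map Prod.fst ≪ m) {B1 B2 : Set X}
    (hB1 : IsCompact B1) (hB2 : IsCompact B2) {δ : ℝ} (hδ : 0 < δ)
    (hdist : ∀ x ∈ B1, ∀ y ∈ B2, δ ≤ dist x y) :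
    ((κ.restrict (Prod.snd ⁻¹' B1)).map Prod.fst) ⟂ₘ ((κ.restrict (Prod.snd ⁻¹' B2)).map Prod.fst) := by
  have hκf := hκ.fin
  by_contra hns
  have ac : ∀ B : Set X, (κ.restrict (Prod.snd ⁻¹' B)).map Prod.fst ≪ m := fun B =>
    (Measure.restrict_le_self.absolutelyContinuous.map measurable_fst).trans hκm
  obtain ⟨D, hD, hD0, C, hC, κ1, κ2, l1, l2, e1, e2⟩ := common measurable_fst (ac B1) (ac B2) hns
  have hin : ∀ (κ' : Measure (X × X)) (B : Set X), IsCompact B → κ' ≤ C • κ.restrict (Prod.snd ⁻¹' B) →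
      ∀ᵐ p ∂κ', p.2 ∈ B := by
    intro κ' B hB hle
    exact ((Measure.absolutelyContinuous_of_le hle).trans Measure.smul_absolutelyContinuous).ae_le
      (ae_restrict_mem (measurable_snd hB.isClosed.measurableSet))
  have i1 := hin κ1 B1 hB1 l1
  have i2 := hin κ2 B2 hB2 l2
  have ho : OptC (κ1 + κ2) := by
    refine (hκ.smul (c := C + C) (ENNReal.add_ne_top.2 ⟨hC, hC⟩)).mono ?_
    rw [add_smul]
    refine add_le_add (l1.trans ?_) (l2.trans ?_) <;>
    · gcongr
      exact Measure.restrict_le_self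
  have x₀ : X := Classical.arbitrary X
  obtain ⟨R, hR⟩ := (hD.union (hB1.union hB2)).isBounded.subset_closedBall x₀
  have hRD : D ⊆ closedBall x₀ R := subset_union_left.trans hR
  have hRB1 : B1 ⊆ closedBall x₀ R := (subset_union_left.trans subset_union_right).trans hR
  have hRB2 : B2 ⊆ closedBall x₀ R := (subset_union_right.trans subset_union_right).trans hR
  set ε : ℝ := min (1/2) (δ / (12 * (|R| + 1))) with hε
  have hRp : 0 < 12 * (|R| + 1) := by positivity
  have hε0 : 0 < ε := lt_min (by norm_num) (by positivity)
  have hε1 : ε ≤ 1/2 := min_le_left _ _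
  have hεδ : ε * (12 * (|R| + 1)) ≤ δ := by
    rw [← le_div_iff₀ hRp]; exact min_le_right _ _
  let s : unitInterval := ⟨1 - ε, by linarith, by linarith⟩
  have hs : (s:ℝ) = 1 - ε := rfl
  have hs1 : (s:ℝ) < 1 := by rw [hs]; linarith
  have hs0 : (0:ℝ) < s := by rw [hs]; linarith
  obtain ⟨D1, hD1D, hD1, hD10, π1, p10, p1s, p11, p1o⟩ :=
    S.lemmaG (ho.mono (Measure.le_add_right le_rfl)) hD hD0 e1 hB1 i1 hs1
  have o1 := p1o κ2 ho
  have mD1 := hD1.isClosed.measurableSet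
  set κ2' := κ2.restrict (Prod.fst ⁻¹' D1) with hκ2'
  have le2' : κ2' ≤ κ2 := Measure.restrict_le_self
  have e2' : κ2'.map Prod.fst = m.restrict D1 := restrict_map_sub measurable_fst mD1 hD1D e2
  have o2 : OptC (κ2' + π1.map ends) := o1.mono (by rw [add_comm]; gcongr)
  obtain ⟨D2, hD2D, hD2, hD20, π2, p20, p2s, p21, p2o⟩ :=
    S.lemmaG (o2.mono (Measure.le_add_right le_rfl)) hD1 hD10 e2' hB2
      ((Measure.absolutelyContinuous_of_le le2').ae_le i2) hs1
  have o3 := p2o _ o2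
  have mD2 := hD2.isClosed.measurableSet
  set π1' := π1.restrict (eval 0 ⁻¹' D2) with hπ1'
  have le1' : π1' ≤ π1 := Measure.restrict_le_self
  have p10' : π1'.map (eval 0) = m.restrict D2 := restrict_map_sub (measurable_eval 0) mD2 hD2D p10
  have f1 : IsFiniteMeasure π1' := finite_of_map (measurable_eval 0) hD2 p10'
  have f2 : IsFiniteMeasure π2 := finite_of_map (measurable_eval 0) hD2 p20
  have o4 : OptC ((π1' + π2).map ends) := by
    refine o3.mono ?_
    rw [Measure.map_add _ _ measurable_ends, add_comm]
    gcongr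
    exact measurable_ends
  have p11' := (Measure.absolutelyContinuous_of_le le1').ae_le p11
  have hz : ∀ π : Measure (Geo X), π.map (eval 0) = m.restrict D2 → ∀ᵐ γ ∂π, eval 0 γ ∈ closedBall x₀ R := by
    intro π hπ
    have : ∀ᵐ γ ∂π, eval 0 γ ∈ D2 := by
      refine (ae_of_map_ae (measurable_eval 0) mD2).1 ?_
      rw [hπ]; exact ae_restrict_mem mD2
    exact this.mono fun γ h => hRD (hD1D (hD2D h))
  have z1 := hz π1' p10'
  have z2 := hz π2 p20
  have hBd : Bd x₀ (3 * R) (π1' + π2) := by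
    rw [Bd, ae_add_measure_iff]
    constructor
    · filter_upwards [p11', z1] with γ h h' using geo_bd h' (hRB1 h)
    · filter_upwards [p21, z2] with γ h h' using geo_bd h' (hRB2 h)
  have o5 := o4.restr hs0 hs1
  have hmp : ∀ (π : Measure (Geo X)) t, (π.map (restr s)).map (eval t) = π.map (eval (s * t)) := by
    intro π t
    rw [Measure.map_map (measurable_eval _) (measurable_restr _)]
    congr 1
  rw [Measure.map_add _ _ (measurable_restr s)] at o5
  have hBd' : Bd x₀ (3 * R) (π1'.map (restr s) + π2.map (restr s)) := by
    rw [← Measure.map_add _ _ (measurable_restr s)]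
    exact hBd.map (measurable_restr s) fun γ t => ⟨_, eval_restr _ _ _⟩
  refine S.no_split (sg1 := π1'.map (restr s)) (sg2 := π2.map (restr s)) hD2 hD20 (by
      rw [hmp, mul_zero, p10']) (by rw [hmp, mul_zero, p20]) o5 hBd' ?_ hs0 hs1 ?_
  · rw [Measure.map_add _ _ (measurable_eval 1), hmp, hmp, mul_one]
    exact Measure.AbsolutelyContinuous.add_left
      (((Measure.absolutelyContinuous_of_le le1').map (measurable_eval s)).trans p1s) p2s
  · rw [hmp, hmp]
    have hclose : ∀ γ : Geo X, eval 0 γ ∈ closedBall x₀ R → eval 1 γ ∈ closedBall x₀ R →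
        dist (eval (s * s) γ) (eval 1 γ) ≤ δ / 3 := by
      intro γ h0 h1
      rw [geo_dist γ (s*s) 1]
      rw [mem_closedBall] at h0 h1
      have h3 := dist_triangle_right (eval 0 γ) (eval 1 γ) x₀
      have h4 := le_abs_self R
      have h5 : |((s*s : unitInterval):ℝ) - ((1:unitInterval):ℝ)| ≤ 2 * ε := by
        rw [abs_sub_comm, Set.Icc.coe_mul, Set.Icc.coe_one, hs, abs_of_nonneg (by nlinarith)]
        nlinarith
      calc _ ≤ (2 * ε) * (2 * |R|) := by
              gcongr
              linarith
        _ ≤ δ / 3 := by nlinarith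
    refine ⟨(cthickening (δ/3) B1)ᶜ, isClosed_cthickening.measurableSet.compl, ?_, ?_⟩
    · have : ∀ᵐ x ∂(π1'.map (eval (s*s))), x ∈ cthickening (δ/3) B1 := by
        refine (ae_of_map_ae (measurable_eval _) isClosed_cthickening.measurableSet).2 ?_
        filter_upwards [p11', z1] with γ h h'
        exact mem_cthickening_of_dist_le _ _ _ _ h (hclose γ h' (hRB1 h))
      exact this
    · have : ∀ᵐ x ∂(π2.map (eval (s*s))), x ∈ (cthickening (δ/3) B1)ᶜ := by
        refine (ae_of_map_ae (measurable_eval _) isClosed_cthickening.measurableSet.compl).2 ?_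
        filter_upwards [p21, z2] with γ h h' hx
        rw [hB1.cthickening_eq_biUnion_closedBall (by linarith)] at hx
        simp only [mem_iUnion, mem_closedBall] at hx
        obtain ⟨y, hy, hy'⟩ := hx
        have a := hclose γ h' (hRB2 h)
        have b := hdist y hy _ h
        have c := dist_triangle_left y (eval 1 γ) (eval (s*s) γ)
        linarith
      exact this
end

section
variable [BorelSpace X] [ProperSpace X]

theorem Setup.graph [Nonempty X] {m : Measure X} {K N : ℝ} (S : Setup m K N) [IsLocallyFiniteMeasure m]
    {κ : Measure (X × X)} (hκ : OptC κ) (hκm : κ.map Prod.fst ≪ m) :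
    ∃ G : Set (X × X), MeasurableSet G ∧ κ Gᶜ = 0 ∧ ∀ x y y', (x, y) ∈ G → (x, y') ∈ G → y = y' := by
  have hx : ∃ d : ℕ → X, DenseRange d := ⟨TopologicalSpace.denseSeq X, TopologicalSpace.denseRange_denseSeq X⟩
  obtain ⟨d, hd⟩ := hx
  let r : ℕ → ℝ := fun n => 1 / ((n:ℝ) + 1)
  have hr : ∀ n, 0 < r n := fun n => by positivity
  have hA : ∀ q : ℕ × ℕ × ℕ, ∃ A : Set X, MeasurableSet A ∧
      (3 * r q.2.2 ≤ dist (d q.1) (d q.2.1) →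
        κ {p | p.2 ∈ closedBall (d q.1) (r q.2.2) ∧ p.1 ∈ A} = 0 ∧
        κ {p | p.2 ∈ closedBall (d q.2.1) (r q.2.2) ∧ p.1 ∈ Aᶜ} = 0) := by
    rintro ⟨i, j, n⟩
    by_cases h : 3 * r n ≤ dist (d i) (d j)
    · obtain ⟨A, hA, h1, h2⟩ := S.sep hκ hκm (isCompact_closedBall (d i) (r n))
        (isCompact_closedBall (d j) (r n)) (hr n) (by
          intro x hx y hy
          rw [mem_closedBall] at hx hy
          have a := dist_triangle4 (d i) x y (d j)
          rw [dist_comm] at hx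
          linarith)
      refine ⟨A, hA, fun _ => ⟨?_, ?_⟩⟩
      · rw [Measure.map_apply measurable_fst hA, Measure.restrict_apply (measurable_fst hA)] at h1
        convert h1 using 2
        ext p; simp [and_comm]
      · rw [Measure.map_apply measurable_fst hA.compl, Measure.restrict_apply (measurable_fst hA.compl)] at h2
        convert h2 using 2
        ext p; simp [and_comm]
    · exact ⟨∅, .empty, fun h' => absurd h' h⟩
  choose A mA hA using hA
  let Bad : ℕ × ℕ × ℕ → Set (X × X) := fun q =>
    if 3 * r q.2.2 ≤ dist (d q.1) (d q.2.1) then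
      {p | p.2 ∈ closedBall (d q.1) (r q.2.2) ∧ p.1 ∈ A q} ∪
      {p | p.2 ∈ closedBall (d q.2.1) (r q.2.2) ∧ p.1 ∈ (A q)ᶜ} else ∅
  have mB : ∀ q, MeasurableSet (Bad q) := by
    intro q
    by_cases h : 3 * r q.2.2 ≤ dist (d q.1) (d q.2.1)
    · simp only [Bad, if_pos h]
      exact ((measurable_snd isClosed_closedBall.measurableSet).inter (measurable_fst (mA q))).union
        ((measurable_snd isClosed_closedBall.measurableSet).inter (measurable_fst (mA q).compl))
    · simp only [Bad, if_neg h]; exact .empty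
  have nB : ∀ q, κ (Bad q) = 0 := by
    intro q
    by_cases h : 3 * r q.2.2 ≤ dist (d q.1) (d q.2.1)
    · simp only [Bad, if_pos h]
      exact measure_union_null (hA q h).1 (hA q h).2
    · simp only [Bad, if_neg h]; exact measure_empty
  refine ⟨(⋃ q, Bad q)ᶜ, (MeasurableSet.iUnion mB).compl, by rw [compl_compl]; exact measure_iUnion_null nB, ?_⟩
  intro x y y' h h'
  by_contra hne
  have hpos : 0 < dist y y' := dist_pos.2 hne
  obtain ⟨n, hn⟩ := exists_nat_one_div_lt (div_pos hpos (by norm_num : (0:ℝ) < 5))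
  have hn' : 5 * r n < dist y y' := by
    change r n < dist y y' / 5 at hn
    linarith
  obtain ⟨i, hi⟩ := hd.exists_dist_lt y (hr n)
  obtain ⟨j, hj⟩ := hd.exists_dist_lt y' (hr n)
  have h3 : 3 * r n ≤ dist (d i) (d j) := by
    have := dist_triangle4 y (d i) (d j) y'
    rw [dist_comm] at hj
    linarith
  rw [mem_compl_iff, mem_iUnion, not_exists] at h h'
  have a := h (i, j, n)
  have b := h' (i, j, n)
  simp only [Bad, if_pos h3, mem_union, mem_setOf_eq, mem_closedBall, not_or, not_and, mem_compl_iff, not_not] at a b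
  exact a.1 hi.le (b.2 hj.le)

/-- a geodesic plan with absolutely continuous start is concentrated on a set where e_0 is injective -/
theorem Setup.inj0 [Nonempty X] {m : Measure X} {K N : ℝ} (S : Setup m K N) [IsLocallyFiniteMeasure m]
    {π : Measure (Geo X)} [IsFiniteMeasure π] (hπ : OptC (π.map ends)) (h0 : π.map (eval 0) ≪ m) :
    ∃ G : Set (Geo X), MeasurableSet G ∧ π Gᶜ = 0 ∧ InjOn (eval 0) G := by
  -- a countable dense set of times
  have hx : ∃ d : ℕ → unitInterval, DenseRange d :=
    ⟨TopologicalSpace.denseSeq _, TopologicalSpace.denseRange_denseSeq _⟩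
  obtain ⟨d, hd⟩ := hx
  have hone : ∀ s : unitInterval, ∃ G : Set (Geo X), MeasurableSet G ∧ π Gᶜ = 0 ∧
      ∀ γ ∈ G, ∀ γ' ∈ G, eval 0 γ = eval 0 γ' → eval s γ = eval s γ' := by
    intro s
    rcases eq_or_ne s 0 with rfl | hs0
    · exact ⟨univ, .univ, by simp, fun γ _ γ' _ h => h⟩
    have hopt : OptC (π.map (fun γ => (eval 0 γ, eval s γ))) := by
      rcases eq_or_ne s 1 with rfl | hs1
      · exact hπ
      have := hπ.restr (s := s) (unitInterval.pos_iff_ne_zero.2 hs0) (unitInterval.lt_one_iff_ne_one.2 hs1)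
      rw [Measure.map_map measurable_ends (measurable_restr s)] at this
      convert this using 2
      ext γ <;> simp [ends]
    have hms : Measurable (fun γ : Geo X => (eval 0 γ, eval s γ)) :=
      (measurable_eval 0).prodMk (measurable_eval s)
    obtain ⟨G, mG, hG, hG'⟩ := S.graph hopt (by
      rw [Measure.map_map measurable_fst hms]; exact h0)
    refine ⟨_, hms mG, ?_, ?_⟩
    · rw [Measure.map_apply hms mG.compl] at hG; exact hG
    · intro γ h γ' h' he
      refine hG' (eval 0 γ) _ _ h ?_
      rw [he]; exact h'
  choose G mG hG hGi using hone
  refine ⟨⋂ n, G (d n), .iInter fun n => mG _, ?_, ?_⟩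
  · rw [compl_iInter]; exact measure_iUnion_null fun n => hG _
  · intro γ h γ' h' he
    rw [mem_iInter] at h h'
    apply geo_ext
    have : (fun t => eval t γ) = fun t => eval t γ' := by
      refine hd.equalizer (γ.1.continuous) (γ'.1.continuous) ?_
      ext n
      exact hGi (d n) γ (h n) γ' (h' n) he
    intro t; exact congrFun this t

/-- the map T -/
theorem exists_T [Nonempty X] (hX : IsGeodesicSpace X) {G : Set (Geo X)} (mG : MeasurableSet G) (hG : InjOn (eval 0) G) :
    ∃ T : X → Geo X, Measurable T ∧ ∀ γ ∈ G, T (eval 0 γ) = γ := by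
  obtain ⟨γ₀, -⟩ := hX (Classical.arbitrary X) (Classical.arbitrary X)
  let f : G → X := fun γ => eval 0 γ.1
  have mf : Measurable f := (measurable_eval 0).comp measurable_subtype_coe
  have hf : Function.Injective f := fun a b h => Subtype.ext (hG a.2 b.2 h)
  have : StandardBorelSpace G := mG.standardBorel
  have hemb := mf.measurableEmbedding hf
  obtain ⟨T, mT, hT⟩ := hemb.exists_measurable_extend (g := fun γ : G => γ.1) measurable_subtype_coe (fun _ => ⟨γ₀⟩)
  exact ⟨T, mT, fun γ hγ => congrFun hT ⟨γ, hγ⟩⟩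

theorem eq_map_T {π : Measure (Geo X)} {G : Set (Geo X)} (hG : π Gᶜ = 0) {T : X → Geo X} (mT : Measurable T)
    (hT : ∀ γ ∈ G, T (eval 0 γ) = γ) : π = (π.map (eval 0)).map T := by
  rw [Measure.map_map mT (measurable_eval 0)]
  conv_lhs => rw [← Measure.map_id (μ := π)]
  apply Measure.map_congr
  have : ∀ᵐ γ ∂π, γ ∈ G := hG
  filter_upwards [this] with γ hγ using (hT γ hγ).symm

/-- uniqueness -/
theorem Setup.unique [Nonempty X] {m : Measure X} {K N : ℝ} (S : Setup m K N) [IsLocallyFiniteMeasure m]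
    {π π' : Measure (Geo X)} [IsFiniteMeasure π] (hπ : OptC (π.map ends)) (hπ' : OptC (π'.map ends))
    (h0 : π.map (eval 0) ≪ m)
    (e0 : π'.map (eval 0) = π.map (eval 0)) (e1 : π'.map (eval 1) = π.map (eval 1)) : π' = π := by
  have f' : IsFiniteMeasure π' := ⟨by
    rw [← preimage_univ (f := eval 0), ← Measure.map_apply (measurable_eval 0) .univ, e0]
    exact measure_lt_top _ _⟩
  have hc : ∫⁻ p, cst p ∂(π'.map ends) ≤ ∫⁻ p, cst p ∂(π.map ends) := by
    refine hπ'.opt _ ?_ ?_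
    · rw [map_ends_fst, map_ends_fst, e0]
    · rw [map_ends_snd, map_ends_snd, e1]
  have ho : OptC ((π + π').map ends) := by
    refine (hπ.smul (c := 2) (by norm_num)).of_same ?_ ?_ ?_
    · rw [map_ends_fst, Measure.map_add _ _ (measurable_eval 0), e0, Measure.map_smul, map_ends_fst, two_smul]
    · rw [map_ends_snd, Measure.map_add _ _ (measurable_eval 1), e1, Measure.map_smul, map_ends_snd, two_smul]
    · rw [Measure.map_add _ _ measurable_ends, lintegral_add_measure, two_smul, lintegral_add_measure]
      gcongr
  obtain ⟨G, mG, hG, hGi⟩ := S.inj0 ho (by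
    rw [Measure.map_add _ _ (measurable_eval 0), e0]
    exact Measure.AbsolutelyContinuous.add_left h0 h0)
  obtain ⟨T, mT, hT⟩ := exists_T S.hX mG hGi
  rw [Measure.add_apply, add_eq_zero] at hG
  rw [eq_map_T hG.1 mT hT, eq_map_T hG.2 mT hT, e0]
end

section
variable [BorelSpace X] [ProperSpace X]

theorem Setup.ac_gen [Nonempty X] {m : Measure X} {K N : ℝ} (S : Setup m K N) [IsLocallyFiniteMeasure m]
    {π : Measure (Geo X)} [IsFiniteMeasure π] (hπ : OptC (π.map ends)) (h0 : π.map (eval 0) ≪ m)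
    {t : unitInterval} (ht : (t:ℝ) < 1) : π.map (eval t) ≪ m := by
  have x₀ : X := Classical.arbitrary X
  let U : ℕ → Set (Geo X) := fun n => {γ | ∀ t, eval t γ ∈ closedBall x₀ (3 * n)}
  have mU : ∀ n, MeasurableSet (U n) := fun n => measurableSet_bd _ _
  have hU : ⋃ n, U n = univ := by
    refine eq_univ_of_forall fun γ => mem_iUnion.2 ?_
    obtain ⟨n, hn⟩ := exists_nat_ge (max (dist (eval 0 γ) x₀) (dist (eval 1 γ) x₀))
    exact ⟨n, geo_bd (mem_closedBall.2 ((le_max_left _ _).trans hn))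
      (mem_closedBall.2 ((le_max_right _ _).trans hn))⟩
  have hn : ∀ n, (π.restrict (U n)).map (eval t) ≪ m := by
    intro n
    have le : π.restrict (U n) ≤ π := Measure.restrict_le_self
    have hac := Measure.absolutelyContinuous_of_le le
    have hB : Bd x₀ (3 * n) (π.restrict (U n)) := ae_restrict_mem (mU n)
    refine S.ac_mid ((hac.map (measurable_eval 0)).trans h0) (fun sg hsg hsg0 => ?_) ht
    have hf : IsFiniteMeasure sg := isFiniteMeasure_of_le _ hsg
    have hp := isProb_normalize sg hsg0
    have ho : OptC (sg.map ends) := hπ.mono (Measure.map_mono (hsg.trans le) measurable_ends)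
    have hsac := Measure.absolutelyContinuous_of_le hsg
    have ho' : OptC (((sg univ)⁻¹ • sg).map ends) := by
      rw [Measure.map_smul]
      exact ho.smul (ENNReal.inv_ne_top.2 (by simpa using hsg0))
    refine S.cd_of_unique hsg0 ho (hB.ac hsac) (fun π'' h'' => ?_) t
    have hc : transportCost π'' ≠ ⊤ := by
      refine ((h''.2.2.2 _ hp rfl rfl).trans_lt (lt_top_iff_ne_top.2 ?_)).ne
      rw [← lint_ends]; exact ho'.cost
    refine S.unique ho' (h''.optC S.hX hc) ?_ h''.2.1 h''.2.2.1
    rw [Measure.map_smul]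
    exact Measure.smul_absolutelyContinuous.trans (((hsac.trans hac).map (measurable_eval 0)).trans h0)
  refine Measure.AbsolutelyContinuous.mk fun E hE hE0 => ?_
  rw [Measure.map_apply (measurable_eval t) hE, ← inter_univ (eval t ⁻¹' E), ← hU, inter_iUnion]
  refine measure_iUnion_null fun n => ?_
  have := hn n hE0
  rwa [Measure.map_apply (measurable_eval t) hE, Measure.restrict_apply (measurable_eval t hE)] at this

theorem cross_ineq (γ η : Geo X) {t : unitInterval} (h : eval t γ = eval t η) :
    dist (eval 0 γ) (eval 1 η) ^ 2 + dist (eval 0 η) (eval 1 γ) ^ 2 ≤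
      dist (eval 0 γ) (eval 1 γ) ^ 2 + dist (eval 0 η) (eval 1 η) ^ 2 := by
  set a := dist (eval 0 γ) (eval 1 γ)
  set b := dist (eval 0 η) (eval 1 η)
  have ht0 := t.2.1
  have ht1 := t.2.2
  have A : ∀ ζ : Geo X, dist (eval 0 ζ) (eval t ζ) = t * dist (eval 0 ζ) (eval 1 ζ) := by
    intro ζ; rw [geo_dist ζ 0 t, Set.Icc.coe_zero, zero_sub, abs_neg, abs_of_nonneg ht0]
  have B : ∀ ζ : Geo X, dist (eval t ζ) (eval 1 ζ) = (1 - t) * dist (eval 0 ζ) (eval 1 ζ) := by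
    intro ζ; rw [geo_dist ζ t 1, Set.Icc.coe_one, abs_sub_comm, abs_of_nonneg (by linarith)]
  have h1 : dist (eval 0 γ) (eval 1 η) ≤ t * a + (1 - t) * b := by
    refine (dist_triangle _ (eval t γ) _).trans ?_
    rw [A]; gcongr; rw [h, B]
  have h2 : dist (eval 0 η) (eval 1 γ) ≤ t * b + (1 - t) * a := by
    refine (dist_triangle _ (eval t η) _).trans ?_
    rw [A]; gcongr; rw [← h, B]
  have p1 := pow_le_pow_left₀ dist_nonneg h1 2
  have p2 := pow_le_pow_left₀ dist_nonneg h2 2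
  nlinarith [mul_nonneg (mul_nonneg ht0 (sub_nonneg.2 ht1)) (sq_nonneg (a - b))]

theorem Setup.cross_bdd [Nonempty X] {m : Measure X} {K N : ℝ} (S : Setup m K N) [IsLocallyFiniteMeasure m]
    {π : Measure (Geo X)} [IsFiniteMeasure π] (hπ : OptC (π.map ends)) (h0 : π.map (eval 0) ≪ m)
    {B : Set X} (hB : IsCompact B) (hπB : ∀ᵐ γ ∂π, eval 0 γ ∈ B ∧ eval 1 γ ∈ B) :
    ∃ G : Set (Geo X), MeasurableSet G ∧ π Gᶜ = 0 ∧ ∀ γ ∈ G, ∀ η ∈ G, ∀ t,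
      eval t γ = eval t η → eval 1 γ = eval 1 η := by
  have hng : Nonempty (Geo X) := by
    obtain ⟨γ₀, -⟩ := S.hX (Classical.arbitrary X) (Classical.arbitrary X)
    exact ⟨γ₀⟩
  set Sp := π.support with hSp
  have hScl : IsClosed Sp := Measure.isClosed_support
  have hSB : Sp ⊆ {γ | eval 0 γ ∈ B ∧ eval 1 γ ∈ B} :=
    Measure.support_subset_of_isClosed (geo_isCompact hB).isClosed hπB
  have hSc : IsCompact Sp := (geo_isCompact hB).of_isClosed_subset hScl hSB
  let r : ℕ → ℝ := fun n => 1 / ((n:ℝ) + 1)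
  have hr : ∀ n, 0 < r n := fun n => by positivity
  let A3 : ℕ → Set ((Geo X × Geo X) × unitInterval) := fun n =>
    ((Sp ×ˢ Sp) ×ˢ univ) ∩ {p | eval p.2 p.1.1 = eval p.2 p.1.2 ∧ r n ≤ dist (eval 1 p.1.1) (eval 1 p.1.2)}
  have hA3 : ∀ n, IsCompact (A3 n) := by
    intro n
    refine ((hSc.prod hSc).prod isCompact_univ).inter_right ?_
    rw [setOf_and]
    refine IsClosed.inter (isClosed_eq ?_ ?_) (isClosed_le continuous_const ?_)
    · exact geo_eval_continuous2.comp ((continuous_fst.comp continuous_fst).prodMk continuous_snd)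
    · exact geo_eval_continuous2.comp ((continuous_snd.comp continuous_fst).prodMk continuous_snd)
    · exact ((geo_eval_continuous 1).comp (continuous_fst.comp continuous_fst)).dist
        ((geo_eval_continuous 1).comp (continuous_snd.comp continuous_fst))
  let A : ℕ → Set (Geo X × Geo X) := fun n => Prod.fst '' A3 n
  have hA : ∀ n, IsCompact (A n) := fun n => (hA3 n).image continuous_fst
  let Q : ℕ → Set (Geo X) := fun n => Prod.fst '' A n
  have hQ : ∀ n, MeasurableSet (Q n) := fun n => ((hA n).image continuous_fst).isClosed.measurableSet
  have hQ0 : ∀ n, π (Q n) = 0 := by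
    intro n
    obtain ⟨f, mf, hf⟩ := exists_selection (hA n)
    set α := π.restrict (Q n) with hα
    have hαπ : α ≤ π := Measure.restrict_le_self
    have hαac := Measure.absolutelyContinuous_of_le hαπ
    have hαQ : ∀ᵐ γ ∂α, γ ∈ Q n := ae_restrict_mem (hQ n)
    have hfp : ∀ γ ∈ Q n, γ ∈ Sp ∧ f γ ∈ Sp ∧ r n ≤ dist (eval 1 γ) (eval 1 (f γ)) ∧
        ∃ t, eval t γ = eval t (f γ) := by
      intro γ hγ
      obtain ⟨⟨p, t⟩, ⟨⟨⟨h1, h2⟩, -⟩, h3, h4⟩, h5⟩ := hf γ hγ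
      simp only at h5
      subst h5
      exact ⟨h1, h2, h4, t, h3⟩
    have m1 : Measurable fun γ : Geo X => (eval 0 γ, eval 1 (f γ)) :=
      (measurable_eval 0).prodMk ((measurable_eval 1).comp mf)
    have m2 : Measurable fun γ : Geo X => (eval 0 (f γ), eval 1 γ) :=
      ((measurable_eval 0).comp mf).prodMk (measurable_eval 1)
    have o1 : OptC ((α + (α + α.map f)).map ends) := by
      refine hπ.of_support hB hπB ?_
      have hs : ∀ᵐ γ ∂α, γ ∈ Sp := hαQ.mono fun γ h => (hfp γ h).1
      rw [ae_add_measure_iff, ae_add_measure_iff]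
      refine ⟨hs, hs, (ae_of_map_ae mf hScl.measurableSet).2 (hαQ.mono fun γ h => (hfp γ h).2.1)⟩
    have o2 : OptC (α.map ends + (α.map (fun γ => (eval 0 γ, eval 1 (f γ))) +
        α.map (fun γ => (eval 0 (f γ), eval 1 γ)))) := by
      refine o1.of_same ?_ ?_ ?_
      · rw [map_ends_fst, Measure.map_add _ _ measurable_fst, Measure.map_add _ _ measurable_fst,
          Measure.map_add _ _ (measurable_eval 0), Measure.map_add _ _ (measurable_eval 0), map_ends_fst,
          Measure.map_map measurable_fst m1, Measure.map_map measurable_fst m2,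
          Measure.map_map (measurable_eval 0) mf]
        rfl
      · rw [map_ends_snd, Measure.map_add _ _ measurable_snd, Measure.map_add _ _ measurable_snd,
          Measure.map_add _ _ (measurable_eval 1), Measure.map_add _ _ (measurable_eval 1), map_ends_snd,
          Measure.map_map measurable_snd m1, Measure.map_map measurable_snd m2,
          Measure.map_map (measurable_eval 1) mf, add_comm (Measure.map (Prod.snd ∘ _) α)]
        rfl
      · rw [Measure.map_add _ _ measurable_ends, Measure.map_add _ _ measurable_ends,
          lintegral_add_measure, lintegral_add_measure, lintegral_add_measure, lintegral_add_measure]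
        gcongr ?_ + ?_
        · exact le_rfl
        rw [lintegral_map measurable_cst m1, lintegral_map measurable_cst m2,
          lintegral_map measurable_cst measurable_ends, Measure.map_map measurable_ends mf,
          lintegral_map measurable_cst (measurable_ends.comp mf), ← lintegral_add_left (f := fun a => cst (eval 0 a, eval 1 (f a))) (measurable_cst.comp m1),
          ← lintegral_add_left (f := fun a => cst (ends a)) (measurable_cst.comp measurable_ends)]
        refine lintegral_mono_ae ?_
        filter_upwards [hαQ] with γ hγ
        obtain ⟨-, -, -, t, ht⟩ := hfp γ hγ
        simp only [cst, ends, Function.comp]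
        rw [← ENNReal.ofReal_add (by positivity) (by positivity), ← ENNReal.ofReal_add (by positivity) (by positivity)]
        exact ENNReal.ofReal_le_ofReal (cross_ineq γ (f γ) ht)
    have o3 : OptC (α.map ends + α.map (fun γ => (eval 0 γ, eval 1 (f γ)))) := by
      refine o2.mono ?_
      rw [← add_assoc]; exact Measure.le_add_right le_rfl
    obtain ⟨G, mG, hG, hGi⟩ := S.graph o3 (by
      rw [Measure.map_add _ _ measurable_fst, map_ends_fst, Measure.map_map measurable_fst m1]
      have := (hαac.map (measurable_eval 0)).trans h0
      exact Measure.AbsolutelyContinuous.add_left this this)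
    rw [Measure.add_apply, add_eq_zero] at hG
    have g1 : ∀ᵐ γ ∂α, ends γ ∈ G := (ae_of_map_ae measurable_ends mG).1 hG.1
    have g2 : ∀ᵐ γ ∂α, (eval 0 γ, eval 1 (f γ)) ∈ G := (ae_of_map_ae m1 mG).1 hG.2
    have : ∀ᵐ γ ∂α, False := by
      filter_upwards [g1, g2, hαQ] with γ a b c
      have h1 := hGi _ _ _ a b
      have h2 := (hfp γ c).2.2.1
      rw [h1, dist_self] at h2
      exact absurd (hr n) (not_lt.2 h2)
    rw [Filter.eventually_false_iff_eq_bot, ae_eq_bot] at this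
    rwa [hα, Measure.restrict_eq_zero] at this
  refine ⟨Sp ∩ (⋃ n, Q n)ᶜ, hScl.measurableSet.inter (MeasurableSet.iUnion hQ).compl, ?_, ?_⟩
  · rw [compl_inter, compl_compl]
    exact measure_union_null Measure.measure_compl_support (measure_iUnion_null hQ0)
  · intro γ hγ η hη t ht
    by_contra hne
    obtain ⟨n, hn⟩ := exists_nat_one_div_lt (dist_pos.2 hne)
    refine hγ.2 (mem_iUnion.2 ⟨n, (γ, η), ⟨((γ, η), t), ⟨⟨⟨hγ.1, hη.1⟩, trivial⟩, ht, hn.le⟩, rfl⟩, rfl⟩)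

theorem Setup.cross [Nonempty X] {m : Measure X} {K N : ℝ} (S : Setup m K N) [IsLocallyFiniteMeasure m]
    {π : Measure (Geo X)} [IsFiniteMeasure π] (hπ : OptC (π.map ends)) (h0 : π.map (eval 0) ≪ m) :
    ∃ G : Set (Geo X), MeasurableSet G ∧ π Gᶜ = 0 ∧ ∀ γ ∈ G, ∀ η ∈ G, ∀ t,
      eval t γ = eval t η → eval 1 γ = eval 1 η := by
  have x₀ : X := Classical.arbitrary X
  let U : ℕ → Set (Geo X) := fun n => {γ | eval 0 γ ∈ closedBall x₀ n ∧ eval 1 γ ∈ closedBall x₀ n}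
  have mU : ∀ n, MeasurableSet (U n) := fun n => (geo_isCompact (isCompact_closedBall x₀ n)).isClosed.measurableSet
  have h := fun n => S.cross_bdd (π := π.restrict (U n))
    (hπ.mono (Measure.map_mono Measure.restrict_le_self measurable_ends))
    ((Measure.restrict_le_self.absolutelyContinuous.map (measurable_eval 0)).trans h0)
    (isCompact_closedBall x₀ n) (ae_restrict_mem (mU n))
  choose G mG hG hGi using h
  refine ⟨⋂ n, (G n ∪ (U n)ᶜ), .iInter fun n => (mG n).union (mU n).compl, ?_, ?_⟩
  · rw [compl_iInter]
    refine measure_iUnion_null fun n => ?_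
    rw [compl_union, compl_compl]
    have := hG n
    rwa [Measure.restrict_apply (mG n).compl] at this
  · intro γ hγ η hη t ht
    rw [mem_iInter] at hγ hη
    obtain ⟨n, hn⟩ := exists_nat_ge (max (max (dist (eval 0 γ) x₀) (dist (eval 1 γ) x₀))
      (max (dist (eval 0 η) x₀) (dist (eval 1 η) x₀)))
    simp only [max_le_iff] at hn
    have a := (hγ n).resolve_right (fun h => h ⟨hn.1.1, hn.1.2⟩)
    have b := (hη n).resolve_right (fun h => h ⟨hn.2.1, hn.2.2⟩)
    exact hGi n γ a η b t ht

theorem Setup.inj_all [Nonempty X] {m : Measure X} {K N : ℝ} (S : Setup m K N) [IsLocallyFiniteMeasure m]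
    {π : Measure (Geo X)} [IsFiniteMeasure π] (hπ : OptC (π.map ends)) (h0 : π.map (eval 0) ≪ m) :
    ∃ G : Set (Geo X), MeasurableSet G ∧ π Gᶜ = 0 ∧ ∀ t : unitInterval, (t:ℝ) < 1 → InjOn (eval t) G := by
  obtain ⟨G0, mG0, hG0, hG0i⟩ := S.inj0 hπ h0
  let q : ℕ → unitInterval := fun n => ⟨1 - 1 / ((n:ℝ) + 2), by
    have : 1 / ((n:ℝ) + 2) ≤ 1 := (div_le_one (by positivity)).2 (by linarith [n.cast_nonneg (α := ℝ)])
    linarith, by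
    have : 0 < 1 / ((n:ℝ) + 2) := by positivity
    linarith⟩
  have hq : ∀ n, ((q n):ℝ) = 1 - 1 / ((n:ℝ) + 2) := fun n => rfl
  have hq1 : ∀ n, ((q n):ℝ) < 1 := fun n => by
    rw [hq]
    have : 0 < 1 / ((n:ℝ) + 2) := by positivity
    linarith
  have hq0 : ∀ n, (0:ℝ) < q n := fun n => by
    rw [hq]
    have : 1 / ((n:ℝ) + 2) < 1 := (div_lt_one (by positivity)).2 (by linarith [n.cast_nonneg (α := ℝ)])
    linarith
  have h1 : ∀ n, ∃ G : Set (Geo X), MeasurableSet G ∧ (π.map (restr (q n))) Gᶜ = 0 ∧ ∀ γ ∈ G, ∀ η ∈ G, ∀ t,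
      eval t γ = eval t η → eval 1 γ = eval 1 η := by
    intro n
    refine S.cross (hπ.restr (hq0 n) (hq1 n)) ?_
    rw [Measure.map_map (measurable_eval 0) (measurable_restr _)]
    convert h0 using 2
    ext γ; simp
  have h2 : ∀ n, ∃ G : Set (Geo X), MeasurableSet G ∧ (π.map (bwd (q n))) Gᶜ = 0 ∧ InjOn (eval 0) G := by
    intro n
    refine S.inj0 (hπ.bwd (hq0 n) (hq1 n)) ?_
    rw [Measure.map_map (measurable_eval 0) (measurable_bwd _)]
    convert S.ac_gen hπ h0 (hq1 n) using 2
    ext γ; simp [eval_bwd]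
  choose G1 mG1 hG1 hG1i using h1
  choose G2 mG2 hG2 hG2i using h2
  refine ⟨G0 ∩ ⋂ n, (restr (q n) ⁻¹' G1 n ∩ bwd (q n) ⁻¹' G2 n),
    mG0.inter (.iInter fun n => (measurable_restr _ (mG1 n)).inter (measurable_bwd _ (mG2 n))), ?_, ?_⟩
  · rw [compl_inter, compl_iInter]
    refine measure_union_null hG0 (measure_iUnion_null fun n => ?_)
    rw [compl_inter]
    refine measure_union_null ?_ ?_
    · have := hG1 n
      rwa [Measure.map_apply (measurable_restr _) (mG1 n).compl] at this
    · have := hG2 n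
      rwa [Measure.map_apply (measurable_bwd _) (mG2 n).compl] at this
  · rintro t ht γ ⟨hγ0, hγ⟩ η ⟨hη0, hη⟩ he
    rw [mem_iInter] at hγ hη
    obtain ⟨n, hn⟩ := exists_nat_one_div_lt (sub_pos.2 ht)
    have htq : (t:ℝ) ≤ q n := by
      rw [hq]
      have : 1 / ((n:ℝ) + 2) ≤ 1 / ((n:ℝ) + 1) := by gcongr; norm_num
      linarith
    let u : unitInterval := ⟨(t:ℝ) / q n, div_nonneg t.2.1 (hq0 n).le, (div_le_one (hq0 n)).2 htq⟩
    have hu : q n * u = t := by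
      apply Subtype.ext
      rw [Set.Icc.coe_mul]
      exact mul_div_cancel₀ _ (hq0 n).ne'
    have a := hG1i n _ (hγ n).1 _ (hη n).1 u (by simp only [eval_restr, hu]; exact he)
    simp only [eval_restr, mul_one] at a
    have b := hG2i n (hγ n).2 (hη n).2 (by simpa [eval_bwd] using a)
    have c := congrArg (eval 1) b
    simp only [eval_bwd, unitInterval.symm_one, mul_zero] at c
    exact hG0i hγ0 hη0 c
end

section
variable [BorelSpace X] [ProperSpace X]

def truncC (n : ℕ) : BoundedContinuousFunction (X × X) ℝ≥0 :=
  BoundedContinuousFunction.mkOfBound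
    ⟨fun p => min (Real.toNNReal (dist p.1 p.2 ^ 2)) n, by fun_prop⟩ n (by
      intro x y
      have h : ∀ p : X × X, (min (Real.toNNReal (dist p.1 p.2 ^ 2)) (n:ℝ≥0) : ℝ≥0) ≤ (n:ℝ) := by
        intro p
        have : min (Real.toNNReal (dist p.1 p.2 ^ 2)) (n:ℝ≥0) ≤ (n:ℝ≥0) := min_le_right _ _
        exact_mod_cast this
      simp only [ContinuousMap.coe_mk]
      rw [NNReal.dist_eq, abs_le]
      constructor
      · have := h y; have := NNReal.coe_nonneg (min (Real.toNNReal (dist x.1 x.2 ^ 2)) (n:ℝ≥0)); linarith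
      · have := h x; have := NNReal.coe_nonneg (min (Real.toNNReal (dist y.1 y.2 ^ 2)) (n:ℝ≥0)); linarith)

theorem truncC_apply (n : ℕ) (p : X × X) : truncC n p = min (Real.toNNReal (dist p.1 p.2 ^ 2)) n := rfl

theorem lint_cst_iSup (κ : Measure (X × X)) : ∫⁻ p, cst p ∂κ = ⨆ n : ℕ, ∫⁻ p, truncC n p ∂κ := by
  rw [← lintegral_iSup]
  · refine lintegral_congr fun p => ?_
    apply le_antisymm
    · obtain ⟨n, hn⟩ := exists_nat_ge (Real.toNNReal (dist p.1 p.2 ^ 2))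
      refine le_iSup_of_le n ?_
      rw [truncC_apply, min_eq_left hn]
      exact le_rfl
    · refine iSup_le fun n => ?_
      rw [truncC_apply]
      exact ENNReal.coe_le_coe.2 (min_le_left _ _)
  · intro n
    exact ((truncC n).continuous.measurable).coe_nnreal_ennreal
  · intro a b hab p
    simp only [truncC_apply]
    exact ENNReal.coe_le_coe.2 (min_le_min_left _ (by exact_mod_cast hab))

theorem lsc_cst : LowerSemicontinuous (fun κ : ProbabilityMeasure (X × X) => ∫⁻ p, cst p ∂(κ : Measure (X × X))) := by
  simp only [lint_cst_iSup]
  exact lowerSemicontinuous_iSup fun n =>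
    (ProbabilityMeasure.continuous_lintegral_boundedContinuousFunction (truncC n)).lowerSemicontinuous

theorem exists_min_coupling (μ ν : Measure X) [hμ : IsProbabilityMeasure μ] [hν : IsProbabilityMeasure ν] :
    ∃ κ : Measure (X × X), IsProbabilityMeasure κ ∧ κ.map Prod.fst = μ ∧ κ.map Prod.snd = ν ∧
      ∀ κ' : Measure (X × X), IsProbabilityMeasure κ' → κ'.map Prod.fst = μ → κ'.map Prod.snd = ν →
        ∫⁻ p, cst p ∂κ ≤ ∫⁻ p, cst p ∂κ' := by
  let μ' : ProbabilityMeasure X := ⟨μ, hμ⟩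
  let ν' : ProbabilityMeasure X := ⟨ν, hν⟩
  let F : ProbabilityMeasure (X × X) → ProbabilityMeasure X :=
    fun κ => κ.map (continuous_fst (X := X) (Y := X)).measurable.aemeasurable
  let G : ProbabilityMeasure (X × X) → ProbabilityMeasure X :=
    fun κ => κ.map (continuous_snd (X := X) (Y := X)).measurable.aemeasurable
  have cF : Continuous F := ProbabilityMeasure.continuous_map continuous_fst
  have cG : Continuous G := ProbabilityMeasure.continuous_map continuous_snd
  let S : Set (ProbabilityMeasure (X × X)) := F ⁻¹' {μ'} ∩ G ⁻¹' {ν'}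
  have hS : ∀ κ : ProbabilityMeasure (X × X), κ ∈ S ↔
      (κ : Measure (X × X)).map Prod.fst = μ ∧ (κ : Measure (X × X)).map Prod.snd = ν := by
    intro κ
    simp only [S, mem_inter_iff, mem_preimage, mem_singleton_iff]
    refine and_congr ?_ ?_
    · exact Subtype.ext_iff
    · exact Subtype.ext_iff
  have clS : IsClosed S := (isClosed_singleton.preimage cF).inter (isClosed_singleton.preimage cG)
  have tS : IsTightMeasureSet {((κ : ProbabilityMeasure (X × X)) : Measure (X × X)) | κ ∈ S} := by
    refine IsTightMeasureSet.prodMk ?_ ?_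
    · refine (isTightMeasureSet_singleton (μ := μ)).subset ?_
      rintro _ ⟨_, ⟨κ, hκ, rfl⟩, rfl⟩
      exact ((hS κ).1 hκ).1
    · refine (isTightMeasureSet_singleton (μ := ν)).subset ?_
      rintro _ ⟨_, ⟨κ, hκ, rfl⟩, rfl⟩
      exact ((hS κ).1 hκ).2
  have cS : IsCompact S := by
    have := isCompact_closure_of_isTightMeasureSet tS
    rwa [clS.closure_eq] at this
  have neS : S.Nonempty := by
    refine ⟨⟨μ.prod ν, inferInstance⟩, (hS _).2 ⟨?_, ?_⟩⟩
    · exact Measure.fst_prod (μ := μ) (ν := ν)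
    · exact Measure.snd_prod (μ := μ) (ν := ν)
  obtain ⟨κ, hκ, hmin⟩ := (lsc_cst.lowerSemicontinuousOn S).exists_isMinOn neS cS
  refine ⟨κ, κ.2, ((hS κ).1 hκ).1, ((hS κ).1 hκ).2, fun κ' p' h1 h2 => ?_⟩
  exact hmin ((hS ⟨κ', p'⟩).2 ⟨h1, h2⟩)

theorem exists_optGeo (hX : IsGeodesicSpace X) (μ ν : Measure X) [IsProbabilityMeasure μ]
    [IsProbabilityMeasure ν] : ∃ π, IsOptGeo μ ν π := by
  obtain ⟨κ, pκ, h1, h2, hmin⟩ := exists_min_coupling μ ν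
  obtain ⟨g, hg, hgp⟩ := exists_geo_selection hX
  have hge : ends ∘ g = id := by
    ext p
    · exact (hgp p).1
    · exact (hgp p).2
  have hge' : (κ.map g).map ends = κ := by
    rw [Measure.map_map measurable_ends hg, hge, Measure.map_id]
  refine ⟨κ.map g, Measure.isProbabilityMeasure_map hg.aemeasurable, ?_, ?_, fun π' p' e0 e1 => ?_⟩
  · rw [← map_ends_fst, hge', h1]
  · rw [← map_ends_snd, hge', h2]
  · rw [← lint_ends, ← lint_ends, hge']
    refine hmin _ (Measure.isProbabilityMeasure_map measurable_ends.aemeasurable) ?_ ?_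
    · rw [map_ends_fst, e0]
    · rw [map_ends_snd, e1]

theorem cost_ne_top {μ ν : Measure X} [IsProbabilityMeasure μ] [IsProbabilityMeasure ν]
    (hμ : HasFiniteSecondMoment μ) (hν : HasFiniteSecondMoment ν) {π : Measure (Geo X)}
    [IsProbabilityMeasure π] (h0 : π.map (eval 0) = μ) (h1 : π.map (eval 1) = ν) :
    transportCost π ≠ ⊤ := by
  obtain ⟨a, ha⟩ := hμ
  obtain ⟨b, hb⟩ := hν
  have ma : Measurable fun x : X => ENNReal.ofReal (dist x a ^ 2) := by fun_prop
  have mb : Measurable fun x : X => ENNReal.ofReal (dist x b ^ 2) := by fun_prop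
  rw [← h0, lintegral_map ma (measurable_eval 0)] at ha
  rw [← h1, lintegral_map mb (measurable_eval 1)] at hb
  have m0 : Measurable fun γ : Geo X => ENNReal.ofReal (dist (eval 0 γ) a ^ 2) := ma.comp (measurable_eval (X := X) 0)
  have m1 : Measurable fun γ : Geo X => ENNReal.ofReal (dist (eval 1 γ) b ^ 2) := mb.comp (measurable_eval (X := X) 1)
  have key : transportCost π ≤ ∫⁻ γ, (3 * ENNReal.ofReal (dist (eval 0 γ) a ^ 2) +
      (3 * ENNReal.ofReal (dist (eval 1 γ) b ^ 2) + ENNReal.ofReal (3 * dist a b ^ 2))) ∂π := by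
    refine lintegral_mono fun γ => ?_
    have e3 : (3 : ℝ≥0∞) = ENNReal.ofReal 3 := by simp
    rw [e3, ← ENNReal.ofReal_mul (by norm_num), ← ENNReal.ofReal_mul (by norm_num),
      ← ENNReal.ofReal_add (by positivity) (by positivity),
      ← ENNReal.ofReal_add (by positivity) (by positivity)]
    refine ENNReal.ofReal_le_ofReal ?_
    have t : dist (eval 0 γ) (eval 1 γ) ≤ dist (eval 0 γ) a + dist a b + dist (eval 1 γ) b := by
      have := dist_triangle4 (eval 0 γ) a b (eval 1 γ)
      rwa [dist_comm b] at this
    have t2 := pow_le_pow_left₀ dist_nonneg t 2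
    nlinarith [sq_nonneg (dist (eval 0 γ) a - dist a b), sq_nonneg (dist (eval 0 γ) a - dist (eval 1 γ) b),
      sq_nonneg (dist (eval 1 γ) b - dist a b)]
  refine (key.trans_lt ?_).ne
  rw [lintegral_add_left (m0.const_mul 3), lintegral_const_mul _ m0, lintegral_add_left (m1.const_mul 3),
    lintegral_const_mul _ m1, lintegral_const, measure_univ, mul_one]
  refine ENNReal.add_lt_top.2 ⟨ENNReal.mul_lt_top (by simp) (lt_top_iff_ne_top.2 ha),
    ENNReal.add_lt_top.2 ⟨ENNReal.mul_lt_top (by simp) (lt_top_iff_ne_top.2 hb), ENNReal.ofReal_lt_top⟩⟩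

end

/-- **Optimal maps** (Theorem 1.1): on a `CD*(K,N)` space with the good transport property,
for `μ,ν ∈ P₂(X)` with `μ ≪ m` there is a unique optimal geodesic plan; it is induced by a map
and concentrated on a set of non-branching geodesics. -/
theorem optimal_maps
    [CompleteSpace X] [TopologicalSpace.SeparableSpace X] [ProperSpace X] [BorelSpace X]
    (hX : IsGeodesicSpace X) (m : Measure X)
    (hm_bdd : ∀ s : Set X, Bornology.IsBounded s → m s ≠ ⊤)
    (hm_supp : ∀ x : X, ∀ r : ℝ, 0 < r → 0 < m (ball x r))
    (K N : ℝ) (hN : 1 ≤ N) (hCD : IsCDStar K N m) (hGT : GoodTransport m)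
    (μ ν : Measure X) (hμp : IsProbabilityMeasure μ) (hνp : IsProbabilityMeasure ν)
    (hμ2 : HasFiniteSecondMoment μ) (hν2 : HasFiniteSecondMoment ν)
    (hμm : μ ≪ m) :
    (∃! π : Measure (Geo X), IsOptGeo μ ν π) ∧
      ∀ π : Measure (Geo X), IsOptGeo μ ν π →
        (∃ T : X → Geo X, Measurable T ∧ π = μ.map T) ∧
        ∃ Γ : Set (Geo X), MeasurableSet Γ ∧ π Γ = 1 ∧
          ∀ t : unitInterval, (t : ℝ) < 1 → Set.InjOn (eval t) Γ := by
  have S : Setup m K N := ⟨hX, hm_bdd, hN, hCD, hGT⟩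
  have hlf : IsLocallyFiniteMeasure m := S.locFin
  have hne : Nonempty X := nonempty_of_isProbabilityMeasure μ
  have hO : ∀ π : Measure (Geo X), IsOptGeo μ ν π → OptC (π.map ends) := fun π h =>
    have := h.1
    h.optC hX (cost_ne_top hμ2 hν2 h.2.1 h.2.2.1)
  refine ⟨?_, fun π h => ?_⟩
  · obtain ⟨π, h⟩ := exists_optGeo hX μ ν
    have hp := h.1
    refine ⟨π, h, fun π' h' => ?_⟩
    have hp' := h'.1
    exact S.unique (hO π h) (hO π' h') (by rw [h.2.1]; exact hμm) (h'.2.1.trans h.2.1.symm)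
      (h'.2.2.1.trans h.2.2.1.symm)
  · have hp := h.1
    have h0 : π.map (eval 0) ≪ m := by rw [h.2.1]; exact hμm
    refine ⟨?_, ?_⟩
    · obtain ⟨G, mG, hG, hi⟩ := S.inj0 (hO π h) h0
      obtain ⟨T, mT, hT⟩ := exists_T hX mG hi
      refine ⟨T, mT, ?_⟩
      have := eq_map_T hG mT hT
      rwa [h.2.1] at this
    · obtain ⟨G, mG, hG, hi⟩ := S.inj_all (hO π h) h0
      exact ⟨G, mG, (prob_compl_eq_zero_iff mG).1 hG, hi⟩

end
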